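/- arXiv:2509.15898 — 6 statements merged into one kernel-verified Lean document; each statement's English description precedes it below -/
import Mathlib

section
/- Let (T, 𝒯, λ) be a complete atomless probability space, ℱ ⊆ 𝒯 a sub-σ-algebra, and X a Polish space. If 𝒯 is nowhere equivalent to ℱ, then for every sub-σ-algebra 𝒢 ⊆ ℱ, every closed-valued ℱ-measurable correspondence F : T ⇉ X, every pair f₁, f₂ of 𝒯-measurable selections of F, and every α ∈ (0,1), there exists a 𝒯-measurable selection f of F such that for every Borel B ⊆ X and every A ∈ 𝒢, λ(A ∩ f⁻¹(B)) = α·λ(A ∩ f₁⁻¹(B)) + (1−α)·λ(A ∩ f₂⁻¹(B)). -/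
open MeasureTheory Set Filter Topology ENNReal

/-- Every non-null set has a measurable subset which is not, up to null sets, the trace of
a `π`-measurable set. -/
def NowhereEquivalentAlong {Ω Y : Type*} [MeasurableSpace Ω] [MeasurableSpace Y]
    (μ : Measure Ω) (π : Ω → Y) : Prop :=
  ∀ D : Set Ω, MeasurableSet D → 0 < μ D →
    ∃ D₀ ⊆ D, MeasurableSet D₀ ∧
      ∀ E : Set Y, MeasurableSet E → 0 < μ (symmDiff D₀ (D ∩ π ⁻¹' E))

/-- A property of sets stable under increasing countable unions is satisfied by a set whose measure
cannot be increased by enlarging it. -/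
theorem exists_maximal_measure {Ω : Type*} [MeasurableSpace Ω] (μ : Measure Ω) [IsFiniteMeasure μ]
    (p : Set Ω → Prop) (hp0 : p ∅)
    (hp : ∀ s : ℕ → Set Ω, Monotone s → (∀ n, p (s n)) → p (⋃ n, s n)) :
    ∃ S, p S ∧ ∀ S', S ⊆ S' → p S' → μ S' ≤ μ S := by
  have step (S : {S // p S}) (n : ℕ) : ∃ N : {S // p S}, S.1 ⊆ N.1 ∧
      ∀ S', S.1 ⊆ S' → p S' → μ S' ≤ μ N.1 + (n + 1 : ℝ≥0∞)⁻¹ := by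
    set r : ℝ≥0∞ := ⨆ N : {N : {S // p S} // S.1 ⊆ N.1}, μ N.1.1 with hr
    have hle (S') (h : S.1 ⊆ S') (h' : p S') : μ S' ≤ r :=
      le_iSup (fun N : {N : {S // p S} // S.1 ⊆ N.1} ↦ μ N.1.1) ⟨⟨S', h'⟩, h⟩
    by_cases h0 : r = 0
    · exact ⟨S, subset_rfl, fun S' h h' ↦ by simp [le_zero_iff.1 ((hle S' h h').trans h0.le)]⟩
    have hfin : r ≠ ∞ :=
      ((iSup_le fun N ↦ measure_mono (subset_univ _)).trans_lt (measure_lt_top μ univ)).ne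
    have hlt : r - (n + 1 : ℝ≥0∞)⁻¹ < r :=
      ENNReal.sub_lt_self hfin h0 (by simp)
    obtain ⟨N, hN⟩ := lt_iSup_iff.1 hlt
    exact ⟨N.1, N.2, fun S' h h' ↦ (hle S' h h').trans (tsub_le_iff_right.1 hN.le)⟩
  choose next hsub hnext using step
  let s : ℕ → {S // p S} := fun n ↦ Nat.rec ⟨∅, hp0⟩ (fun n S ↦ next S n) n
  have hs : Monotone fun n ↦ (s n).1 := monotone_nat_of_le_succ fun n ↦ hsub (s n) n
  refine ⟨⋃ n, (s n).1, hp _ hs fun n ↦ (s n).2, fun S' hS' hpS' ↦ ?_⟩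
  refine le_of_tendsto' (x := atTop)
    (f := fun n : ℕ ↦ μ S' - (n + 1 : ℝ≥0∞)⁻¹) ?_ fun n ↦ ?_
  · have h : Tendsto (fun n : ℕ ↦ ((n + 1 : ℕ) : ℝ≥0∞)⁻¹) atTop (𝓝 0) :=
      ENNReal.tendsto_inv_nat_nhds_zero.comp (tendsto_add_atTop_nat 1)
    simpa using ENNReal.Tendsto.sub (tendsto_const_nhds (x := μ S')) h (.inl (measure_ne_top μ _))
  · refine tsub_le_iff_right.2 ((hnext (s n) n S' ((subset_iUnion _ n).trans hS') hpS').trans ?_)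
    gcongr
    exact subset_iUnion (fun n ↦ (s n).1) (n + 1)

namespace NowhereEquivalentAlong

variable {Ω Y : Type*} [MeasurableSpace Ω] [MeasurableSpace Y] {μ : Measure Ω} [IsFiniteMeasure μ]
  {π : Ω → Y}

theorem exists_two_mul_le (h : NowhereEquivalentAlong μ π) (hπ : Measurable π) {D : Set Ω}
    (hD : MeasurableSet D) (hD0 : 0 < μ D) :
    ∃ D₁ ⊆ D, MeasurableSet D₁ ∧ 0 < μ D₁ ∧
      ∀ E, MeasurableSet E → 2 * μ (D₁ ∩ π ⁻¹' E) ≤ μ (D ∩ π ⁻¹' E) := by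
  obtain ⟨D₀, hsub, hD₀, hne⟩ := h D hD hD0
  obtain ⟨s, hs, hs1, hs2⟩ := hahn_decomposition ((μ.restrict D₀).map π)
    ((μ.restrict (D \ D₀)).map π)
  have e1 (t : Set Y) (ht : MeasurableSet t) : (μ.restrict D₀).map π t = μ (D₀ ∩ π ⁻¹' t) := by
    rw [Measure.map_apply hπ ht, Measure.restrict_apply (hπ ht), inter_comm]
  have e2 (t : Set Y) (ht : MeasurableSet t) :
      (μ.restrict (D \ D₀)).map π t = μ ((D \ D₀) ∩ π ⁻¹' t) := by
    rw [Measure.map_apply hπ ht, Measure.restrict_apply (hπ ht), inter_comm]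
  refine ⟨(D₀ ∩ π ⁻¹' sᶜ) ∪ ((D \ D₀) ∩ π ⁻¹' s), by grind, ?_, ?_, fun E hE ↦ ?_⟩
  · exact (hD₀.inter (hπ hs.compl)).union ((hD.diff hD₀).inter (hπ hs))
  · convert hne s hs using 2
    ext ω
    simp only [mem_union, mem_inter_iff, mem_preimage, mem_compl_iff, Set.mem_sdiff, mem_symmDiff]
    have := @hsub ω
    tauto
  · have a1 := hs1 (E ∩ s) (hE.inter hs) inter_subset_right
    have a2 := hs2 (E ∩ sᶜ) (hE.inter hs.compl) inter_subset_right
    rw [e1 _ (hE.inter hs), e2 _ (hE.inter hs)] at a1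
    rw [e1 _ (hE.inter hs.compl), e2 _ (hE.inter hs.compl)] at a2
    have b1 : μ (((D₀ ∩ π ⁻¹' sᶜ) ∪ ((D \ D₀) ∩ π ⁻¹' s)) ∩ π ⁻¹' E) ≤
        μ (D₀ ∩ π ⁻¹' (E ∩ sᶜ)) + μ ((D \ D₀) ∩ π ⁻¹' (E ∩ s)) := by
      refine (measure_mono ?_).trans (measure_union_le _ _)
      intro ω
      simp only [mem_union, mem_inter_iff, mem_preimage, mem_compl_iff, Set.mem_sdiff]
      tauto
    have c0 := measure_inter_add_sdiff (μ := μ) (D ∩ π ⁻¹' E) hD₀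
    have c1 := measure_inter_add_sdiff (μ := μ) (D ∩ π ⁻¹' E ∩ D₀) (hπ hs)
    have c2 := measure_inter_add_sdiff (μ := μ) ((D ∩ π ⁻¹' E) \ D₀) (hπ hs)
    have d1 : D ∩ π ⁻¹' E ∩ D₀ ∩ π ⁻¹' s = D₀ ∩ π ⁻¹' (E ∩ s) := by
      ext ω; have := @hsub ω; simp only [mem_inter_iff, mem_preimage]; tauto
    have d2 : (D ∩ π ⁻¹' E ∩ D₀) \ π ⁻¹' s = D₀ ∩ π ⁻¹' (E ∩ sᶜ) := by
      ext ω; have := @hsub ω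
      simp only [mem_inter_iff, mem_preimage, Set.mem_sdiff, mem_compl_iff]; tauto
    have d3 : ((D ∩ π ⁻¹' E) \ D₀) ∩ π ⁻¹' s = (D \ D₀) ∩ π ⁻¹' (E ∩ s) := by
      ext ω; simp only [mem_inter_iff, mem_preimage, Set.mem_sdiff]; tauto
    have d4 : ((D ∩ π ⁻¹' E) \ D₀) \ π ⁻¹' s = (D \ D₀) ∩ π ⁻¹' (E ∩ sᶜ) := by
      ext ω; simp only [mem_inter_iff, mem_preimage, Set.mem_sdiff, mem_compl_iff]; tauto
    rw [d1, d2] at c1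
    rw [d3, d4] at c2
    rw [← c0, ← c1, ← c2, two_mul]
    refine (add_le_add b1 b1).trans ?_
    calc _ = (μ ((D \ D₀) ∩ π ⁻¹' (E ∩ s)) + μ (D₀ ∩ π ⁻¹' (E ∩ sᶜ))) +
          (μ ((D \ D₀) ∩ π ⁻¹' (E ∩ s)) + μ (D₀ ∩ π ⁻¹' (E ∩ sᶜ))) := by ring
      _ ≤ (μ (D₀ ∩ π ⁻¹' (E ∩ s)) + μ (D₀ ∩ π ⁻¹' (E ∩ sᶜ))) +
          (μ ((D \ D₀) ∩ π ⁻¹' (E ∩ s)) + μ ((D \ D₀) ∩ π ⁻¹' (E ∩ sᶜ))) := by gcongr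

theorem exists_le_mul (h : NowhereEquivalentAlong μ π) (hπ : Measurable π) {D : Set Ω}
    (hD : MeasurableSet D) (hD0 : 0 < μ D) {ε : ℝ≥0∞} (hε : ε ≠ 0) :
    ∃ D₁ ⊆ D, MeasurableSet D₁ ∧ 0 < μ D₁ ∧
      ∀ E, MeasurableSet E → μ (D₁ ∩ π ⁻¹' E) ≤ ε * μ (D ∩ π ⁻¹' E) := by
  have key (n : ℕ) : ∃ D₁ ⊆ D, MeasurableSet D₁ ∧ 0 < μ D₁ ∧
      ∀ E, MeasurableSet E → μ (D₁ ∩ π ⁻¹' E) ≤ 2⁻¹ ^ n * μ (D ∩ π ⁻¹' E) := by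
    induction n with
    | zero => exact ⟨D, subset_rfl, hD, hD0, by simp⟩
    | succ n ih =>
      obtain ⟨D₁, hs, hm, h0, hle⟩ := ih
      obtain ⟨D₂, hs', hm', h0', hle'⟩ := h.exists_two_mul_le hπ hm h0
      refine ⟨D₂, hs'.trans hs, hm', h0', fun E hE ↦ ?_⟩
      have := (ENNReal.mul_le_iff_le_inv two_ne_zero ofNat_ne_top).1 (hle' E hE)
      rw [pow_succ', mul_assoc]
      exact this.trans (by gcongr; exact hle E hE)
  obtain ⟨n, hn⟩ := ENNReal.exists_inv_two_pow_lt hε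
  obtain ⟨D₁, hs, hm, h0, hle⟩ := key n
  exact ⟨D₁, hs, hm, h0, fun E hE ↦ (hle E hE).trans (by gcongr)⟩

/-- Every measurable set can be halved independently of `π`. -/
theorem exists_two_mul_eq (h : NowhereEquivalentAlong μ π) (hπ : Measurable π) {D : Set Ω}
    (hD : MeasurableSet D) :
    ∃ S ⊆ D, MeasurableSet S ∧
      ∀ E, MeasurableSet E → 2 * μ (S ∩ π ⁻¹' E) = μ (D ∩ π ⁻¹' E) := by
  obtain ⟨S, ⟨hSD, hS, hle⟩, hmax⟩ := exists_maximal_measure μ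
    (fun S ↦ S ⊆ D ∧ MeasurableSet S ∧
      ∀ E, MeasurableSet E → 2 * μ (S ∩ π ⁻¹' E) ≤ μ (D ∩ π ⁻¹' E)) (by simp) (by
      intro s hs hp
      refine ⟨iUnion_subset fun n ↦ (hp n).1, .iUnion fun n ↦ (hp n).2.1, fun E hE ↦ ?_⟩
      rw [iUnion_inter, Monotone.measure_iUnion
        (fun i j hij ↦ inter_subset_inter_left _ (hs hij)), ENNReal.mul_iSup]
      exact iSup_le fun n ↦ (hp n).2.2 E hE)
  refine ⟨S, hSD, hS, fun E₀ hE₀ ↦ le_antisymm (hle E₀ hE₀) ?_⟩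
  by_contra! hlt
  have e (A : Set Ω) (t : Set Y) (ht : MeasurableSet t) :
      (μ.restrict A).map π t = μ (A ∩ π ⁻¹' t) := by
    rw [Measure.map_apply hπ ht, Measure.restrict_apply (hπ ht), inter_comm]
  have hνle : (2 : ℝ≥0∞) • (μ.restrict S).map π ≤ (μ.restrict D).map π :=
    Measure.le_iff.2 fun t ht ↦ by simpa [e _ t ht] using hle t ht
  have : IsFiniteMeasure ((2 : ℝ≥0∞) • (μ.restrict S).map π) :=
    isFiniteMeasure_of_le _ hνle
  set m : Measure Y := (μ.restrict D).map π - (2 : ℝ≥0∞) • (μ.restrict S).map π with hm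
  have hm_apply (t : Set Y) (ht : MeasurableSet t) :
      m t = μ (D ∩ π ⁻¹' t) - 2 * μ (S ∩ π ⁻¹' t) := by
    rw [hm, Measure.sub_apply ht hνle]; simp [e _ t ht]
  have hsplit (t : Set Y) (ht : MeasurableSet t) :
      μ (D ∩ π ⁻¹' t) = μ (S ∩ π ⁻¹' t) + μ ((D \ S) ∩ π ⁻¹' t) := by
    rw [← measure_inter_add_sdiff (D ∩ π ⁻¹' t) hS]
    congr 2 <;> ext ω <;> have := @hSD ω <;>
      simp only [mem_inter_iff, Set.mem_sdiff, mem_preimage] <;> tauto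
  have hmC : m ≤ (μ.restrict (D \ S)).map π := by
    refine Measure.le_iff.2 fun t ht ↦ ?_
    rw [hm_apply t ht, e _ t ht, hsplit t ht, tsub_le_iff_right, two_mul]
    rw [add_comm]
    gcongr
    exact le_self_add
  have hsing : ¬ m ⟂ₘ (μ.restrict (D \ S)).map π := by
    intro hsing
    have h0 := Measure.eq_zero_of_absolutelyContinuous_of_mutuallySingular
      (Measure.absolutelyContinuous_of_le hmC) hsing
    have := hm_apply E₀ hE₀
    rw [h0] at this
    exact absurd (tsub_eq_zero_iff_le.1 this.symm) (not_le.2 hlt)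
  obtain ⟨ε, hε, E, hE, hE0, hεE⟩ := Measure.exists_positive_of_not_mutuallySingular _ _ hsing
  rw [e _ _ hE] at hE0
  obtain ⟨D₁, hs1, hm1, hpos, hle1⟩ := h.exists_le_mul hπ ((hD.diff hS).inter (hπ hE)) hE0
    (ε := ε / 2) (by simp [hε.ne'])
  have hdisj : Disjoint S D₁ := disjoint_left.2 fun ω h1 h2 ↦ (hs1 h2).1.2 h1
  refine absurd (hmax (S ∪ D₁) subset_union_left ⟨?_, hS.union hm1, fun A hA ↦ ?_⟩) ?_
  · exact union_subset hSD (hs1.trans (inter_subset_left.trans sdiff_subset))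
  · have h1 := hle1 A hA
    have h2 := hεE A hA
    rw [e _ _ (hA.inter hE), hm_apply _ (hA.inter hE)] at h2
    have h3 : 2 * μ (D₁ ∩ π ⁻¹' A) ≤ m A := by
      calc 2 * μ (D₁ ∩ π ⁻¹' A)
          ≤ 2 * (ε / 2 * μ ((D \ S) ∩ π ⁻¹' E ∩ π ⁻¹' A)) := by gcongr
        _ = ε * μ ((D \ S) ∩ π ⁻¹' (A ∩ E)) := by
          rw [← mul_assoc, ENNReal.mul_div_cancel two_ne_zero ofNat_ne_top, preimage_inter,
            inter_assoc, inter_comm (π ⁻¹' E)]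
        _ ≤ m (A ∩ E) := by rw [hm_apply _ (hA.inter hE)]; exact h2
        _ ≤ m A := measure_mono inter_subset_left
    rw [hm_apply A hA] at h3
    calc 2 * μ ((S ∪ D₁) ∩ π ⁻¹' A)
        ≤ 2 * (μ (S ∩ π ⁻¹' A) + μ (D₁ ∩ π ⁻¹' A)) := by
          gcongr; rw [union_inter_distrib_right]; exact measure_union_le _ _
      _ ≤ 2 * μ (S ∩ π ⁻¹' A) + (μ (D ∩ π ⁻¹' A) - 2 * μ (S ∩ π ⁻¹' A)) := by
          rw [mul_add]; gcongr
      _ = μ (D ∩ π ⁻¹' A) := add_tsub_cancel_of_le (hle A hA)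
  · rw [measure_union hdisj hm1, not_le]
    exact ENNReal.lt_add_right (measure_ne_top _ _) hpos.ne'

theorem exists_two_mul_fiber_eq (h : NowhereEquivalentAlong μ π) (hπ : Measurable π) {g : Ω → ℕ}
    (hg : Measurable g) :
    ∃ S, MeasurableSet S ∧ ∀ k E, MeasurableSet E →
      2 * μ (S ∩ g ⁻¹' {k} ∩ π ⁻¹' E) = μ (g ⁻¹' {k} ∩ π ⁻¹' E) := by
  choose S hsub hS hSE using fun k ↦ h.exists_two_mul_eq hπ (hg (measurableSet_singleton k))
  refine ⟨⋃ k, S k, .iUnion hS, fun k E hE ↦ ?_⟩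
  rw [← hSE k E hE]
  congr 3
  ext ω
  simp only [mem_inter_iff, mem_iUnion, mem_preimage, mem_singleton_iff]
  constructor
  · rintro ⟨⟨j, hj⟩, hk⟩
    obtain rfl : g ω = j := hsub j hj
    rwa [← hk]
  · exact fun hk ↦ ⟨⟨k, hk⟩, hsub k hk⟩

theorem exists_dyadic (h : NowhereEquivalentAlong μ π) (hπ : Measurable π) :
    ∃ u : ℕ → Ω → ℕ, (∀ n, Measurable (u n)) ∧ (∀ ω, u 0 ω = 0) ∧
      (∀ n ω, u (n + 1) ω = 2 * u n ω ∨ u (n + 1) ω = 2 * u n ω + 1) ∧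
      ∀ n k E, MeasurableSet E → k < 2 ^ n →
        2 ^ n * μ (u n ⁻¹' {k} ∩ π ⁻¹' E) = μ (π ⁻¹' E) := by
  classical
  choose S hS hSE using fun g : {g : Ω → ℕ // Measurable g} ↦ h.exists_two_mul_fiber_eq hπ g.2
  let u : ℕ → {g : Ω → ℕ // Measurable g} := fun n ↦ Nat.rec ⟨fun _ ↦ 0, measurable_const⟩
    (fun _ g ↦ ⟨fun ω ↦ 2 * g.1 ω + (S g).indicator 1 ω,
      (g.2.const_mul 2).add (measurable_one.indicator (hS g))⟩) n
  have hu (n ω) : (u (n + 1)).1 ω = 2 * (u n).1 ω + (S (u n)).indicator 1 ω := rfl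
  refine ⟨fun n ↦ (u n).1, fun n ↦ (u n).2, fun _ ↦ rfl, fun n ω ↦ ?_, fun n ↦ ?_⟩
  · by_cases hω : ω ∈ S (u n) <;> simp [hu, hω]
  induction n with
  | zero =>
    intro k E hE hk
    obtain rfl : k = 0 := by simpa using hk
    have : (u 0).1 ⁻¹' {0} = univ := eq_univ_of_forall fun _ ↦ rfl
    simp [this]
  | succ n ih =>
    intro k E hE hk
    have hj : k / 2 < 2 ^ n := by omega
    have h1 := hSE (u n) (k / 2) E hE
    have h2 := measure_inter_add_sdiff (μ := μ) ((u n).1 ⁻¹' {k / 2} ∩ π ⁻¹' E) (hS (u n))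
    have e1 : (u n).1 ⁻¹' {k / 2} ∩ π ⁻¹' E ∩ S (u n) =
        S (u n) ∩ (u n).1 ⁻¹' {k / 2} ∩ π ⁻¹' E := by
      rw [inter_comm, inter_assoc]
    have h3 : μ (((u n).1 ⁻¹' {k / 2} ∩ π ⁻¹' E) \ S (u n)) =
        μ (S (u n) ∩ (u n).1 ⁻¹' {k / 2} ∩ π ⁻¹' E) := by
      rw [e1, ← h1, two_mul] at h2
      exact (ENNReal.add_right_inj (measure_ne_top _ _)).1 h2
    rw [pow_succ, mul_assoc, ← ih (k / 2) E hE hj, ← h1]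
    congr 2
    rcases Nat.even_or_odd' k with ⟨j, rfl | rfl⟩
    · rw [← h3]
      congr 1
      ext ω
      by_cases hω : ω ∈ S (u n) <;> simp [hu, hω] <;> omega
    · congr 1
      ext ω
      by_cases hω : ω ∈ S (u n) <;> simp [hu, hω] <;> omega

/-- There is a uniform random variable independent of `π`. -/
theorem exists_map_prodMk_eq_prod_volume (h : NowhereEquivalentAlong μ π) (hπ : Measurable π) :
    ∃ U : Ω → unitInterval, Measurable U ∧
      μ.map (fun ω ↦ (π ω, U ω)) = (μ.map π).prod volume := by
  obtain ⟨u, hu, hu0, hstep, hmeas⟩ := h.exists_dyadic hπ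
  have hlt (n ω) : u n ω < 2 ^ n := by
    induction n with
    | zero => simp [hu0]
    | succ n ih => rcases hstep n ω with h | h <;> rw [h, pow_succ] <;> omega
  have hmono (ω) : Monotone fun n ↦ (u n ω : ℝ) / 2 ^ n := monotone_nat_of_le_succ fun n ↦ by
    rw [div_le_div_iff₀ (by positivity) (by positivity), pow_succ]
    have : (2 * u n ω : ℝ) ≤ u (n + 1) ω := by
      exact_mod_cast (by rcases hstep n ω with h | h <;> omega : 2 * u n ω ≤ u (n + 1) ω)
    nlinarith [pow_pos (two_pos (α := ℝ)) n]
  have hanti (ω) : Antitone fun n ↦ ((u n ω : ℝ) + 1) / 2 ^ n := antitone_nat_of_succ_le fun n ↦ by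
    rw [div_le_div_iff₀ (by positivity) (by positivity), pow_succ]
    have : (u (n + 1) ω : ℝ) ≤ 2 * u n ω + 1 := by
      exact_mod_cast (by rcases hstep n ω with h | h <;> omega : u (n + 1) ω ≤ 2 * u n ω + 1)
    nlinarith [pow_pos (two_pos (α := ℝ)) n]
  have hle (ω m n) : (u m ω : ℝ) / 2 ^ m ≤ (u n ω + 1) / 2 ^ n := by
    refine (hmono ω (le_max_left m n)).trans (le_trans ?_ (hanti ω (le_max_right m n)))
    dsimp only
    gcongr
    simp
  have hmem (ω n) : (u n ω : ℝ) / 2 ^ n ∈ unitInterval :=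
    ⟨by positivity, (hle ω n n).trans ((hanti ω n.zero_le).trans (by simp [hu0]))⟩
  let U : Ω → unitInterval := fun ω ↦ ⨆ n, ⟨(u n ω : ℝ) / 2 ^ n, hmem ω n⟩
  have hU : Measurable U := .iSup fun n ↦ Measurable.subtype_mk (by fun_prop)
  have hU1 (n ω) : (u n ω : ℝ) / 2 ^ n ≤ U ω :=
    Subtype.coe_le_coe.2 (le_iSup (fun n ↦ (⟨(u n ω : ℝ) / 2 ^ n, hmem ω n⟩ : unitInterval)) n)
  have hU2 (n ω) (x : unitInterval) (hx : ((u n ω : ℝ) + 1) / 2 ^ n ≤ x) : U ω ≤ x :=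
    iSup_le fun m ↦ Subtype.coe_le_coe.1 ((hle ω m n).trans hx)
  refine ⟨U, hU, (Measure.prod_eq fun E B hE hB ↦ ?_).symm⟩
  have hcdf (n k) (hk : k ≤ 2 ^ n) :
      2 ^ n * μ.real (u n ⁻¹' Iio k ∩ π ⁻¹' E) = k * μ.real (π ⁻¹' E) := by
    induction k with
    | zero => simp
    | succ k ih =>
      have e : u n ⁻¹' Iio (k + 1) ∩ π ⁻¹' E =
          (u n ⁻¹' Iio k ∩ π ⁻¹' E) ∪ (u n ⁻¹' {k} ∩ π ⁻¹' E) := by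
        ext ω
        simp only [mem_inter_iff, mem_preimage, mem_Iio, mem_union, mem_singleton_iff]
        grind
      rw [e, measureReal_union (disjoint_left.2 fun ω h1 h2 ↦ (by
          simp only [mem_inter_iff, mem_preimage, mem_Iio, mem_singleton_iff] at h1 h2; omega))
        ((hu n (measurableSet_singleton k)).inter (hπ hE)), mul_add, ih (by omega)]
      have := congrArg ENNReal.toReal (hmeas n k E hE (by omega))
      simp only [ENNReal.toReal_mul, ENNReal.toReal_pow, ENNReal.toReal_ofNat] at this
      simp only [measureReal_def]
      rw [this]; push_cast; ring
  have hlaw : (μ.restrict (π ⁻¹' E)).map U = μ (π ⁻¹' E) • (volume : Measure unitInterval) := by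
    have : IsFiniteMeasure (μ (π ⁻¹' E) • (volume : Measure unitInterval)) :=
      Measure.smul_finite _ (measure_ne_top _ _)
    refine Measure.ext_of_Iic _ _ fun x ↦ ?_
    rw [Measure.map_apply hU measurableSet_Iic, Measure.restrict_apply (hU measurableSet_Iic),
      Measure.smul_apply, unitInterval.volume_Iic, smul_eq_mul,
      ← ENNReal.toReal_eq_toReal_iff' (measure_ne_top _ _)
        (ENNReal.mul_ne_top (measure_ne_top _ _) ofReal_ne_top),
      ENNReal.toReal_mul, ENNReal.toReal_ofReal x.2.1, ← measureReal_def, ← measureReal_def]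
    set c := μ.real (π ⁻¹' E)
    set G := μ.real (U ⁻¹' Iic x ∩ π ⁻¹' E)
    have hc : 0 ≤ c := measureReal_nonneg
    have bound (n : ℕ) : |G - c * x| * 2 ^ n ≤ c := by
      have h2 : (0 : ℝ) < 2 ^ n := by positivity
      set k := ⌊(2 : ℝ) ^ n * x⌋₊
      have hk1 : (k : ℝ) ≤ 2 ^ n * x := Nat.floor_le (mul_nonneg h2.le x.2.1)
      have hk2 : 2 ^ n * x < (k : ℝ) + 1 := Nat.lt_floor_add_one _
      have hk : k ≤ 2 ^ n := by
        have : (k : ℝ) ≤ 2 ^ n := hk1.trans (mul_le_of_le_one_right h2.le x.2.2)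
        exact_mod_cast this
      have lower : k * c ≤ 2 ^ n * G := by
        rw [← hcdf n k hk]
        refine mul_le_mul_of_nonneg_left (measureReal_mono ?_) h2.le
        refine inter_subset_inter_left _ fun ω hω ↦ hU2 n ω x ?_
        rw [div_le_iff₀ h2, mul_comm]
        refine le_trans ?_ hk1
        exact_mod_cast (show u n ω < k from hω)
      have upper : 2 ^ n * G ≤ (k + 1) * c := by
        rcases hk.eq_or_lt with hk' | hk'
        · have : G ≤ c := measureReal_mono inter_subset_right
          have hk'' : (k : ℝ) = 2 ^ n := by exact_mod_cast hk'
          rw [hk'']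
          nlinarith
        · have := hcdf n (k + 1) hk'
          push_cast at this
          rw [← this]
          refine mul_le_mul_of_nonneg_left (measureReal_mono ?_) h2.le
          refine inter_subset_inter_left _ fun ω hω ↦ ?_
          have h3 : (u n ω : ℝ) / 2 ^ n ≤ x := (hU1 n ω).trans (Subtype.coe_le_coe.2 hω)
          rw [div_le_iff₀ h2, mul_comm] at h3
          exact Nat.lt_succ_of_le (Nat.le_floor h3)
      rw [← abs_of_pos h2, ← abs_mul, abs_le]
      constructor <;> nlinarith
    by_contra hne
    have hpos : 0 < |G - c * x| := abs_pos.2 (sub_ne_zero.2 hne)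
    obtain ⟨n, hn⟩ := pow_unbounded_of_one_lt (c / |G - c * x|) (one_lt_two (α := ℝ))
    rw [div_lt_iff₀ hpos, mul_comm] at hn
    exact absurd (bound n) (not_le.2 hn)
  have := congrArg (fun ν ↦ ν B) hlaw
  simp only [Measure.map_apply hU hB, Measure.restrict_apply (hU hB), Measure.smul_apply,
    smul_eq_mul] at this
  rw [Measure.map_apply (hπ.prodMk hU) (hE.prod hB), Measure.map_apply hπ hE, ← this, inter_comm]
  rfl

/-- Every joint law with first marginal the law of `π` is realised by some `(π, f)`. -/
theorem exists_map_prodMk_eq (h : NowhereEquivalentAlong μ π) (hπ : Measurable π)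
    {X : Type*} [MeasurableSpace X] [StandardBorelSpace X] [Nonempty X]
    (ρ : Measure (Y × X)) (hρ : ρ.fst = μ.map π) :
    ∃ f : Ω → X, Measurable f ∧ μ.map (fun ω ↦ (π ω, f ω)) = ρ := by
  have : IsFiniteMeasure ρ := ⟨by
    rw [← Measure.fst_univ, hρ]; exact measure_lt_top _ _⟩
  obtain ⟨U, hU, hlaw⟩ := h.exists_map_prodMk_eq_prod_volume hπ
  obtain ⟨g, hg, hgκ⟩ := ProbabilityTheory.Kernel.exists_measurable_map_eq_unitInterval ρ.condKernel
  have hg' : Measurable fun p : Y × unitInterval ↦ (p.1, g p.1 p.2) := measurable_fst.prodMk hg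
  refine ⟨fun ω ↦ g (π ω) (U ω), hg.comp (hπ.prodMk hU), ?_⟩
  have e : (fun ω ↦ (π ω, g (π ω) (U ω))) =
      (fun p : Y × unitInterval ↦ (p.1, g p.1 p.2)) ∘ fun ω ↦ (π ω, U ω) := rfl
  rw [e, ← Measure.map_map hg' (hπ.prodMk hU), hlaw]
  conv_rhs => rw [← ρ.disintegrate ρ.condKernel, hρ]
  refine Measure.ext fun s hs ↦ ?_
  rw [Measure.map_apply hg' hs, Measure.prod_apply (hg' hs), Measure.compProd_apply hs]
  refine lintegral_congr fun y ↦ ?_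
  rw [← hgκ y, Measure.map_apply hg.of_uncurry_left (measurable_prodMk_left hs)]
  rfl

end NowhereEquivalentAlong

/-- Mixtures of the conditional laws given `π` of two functions are again conditional laws. -/
theorem NowhereEquivalentAlong.exists_mixture {Ω Y X : Type*} [MeasurableSpace Ω]
    [MeasurableSpace Y] [MeasurableSpace X] [StandardBorelSpace X]
    {μ : Measure Ω} [IsProbabilityMeasure μ] {π : Ω → Y}
    (h : NowhereEquivalentAlong μ π) (hπ : Measurable π) {G : Set (Y × X)} (hG : MeasurableSet G)
    {f₁ f₂ : Ω → X} (hf₁ : Measurable f₁) (hf₂ : Measurable f₂)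
    (hf₁G : ∀ᵐ ω ∂μ, (π ω, f₁ ω) ∈ G) (hf₂G : ∀ᵐ ω ∂μ, (π ω, f₂ ω) ∈ G)
    {α : ℝ≥0∞} (hα : α ≤ 1) :
    ∃ f : Ω → X, Measurable f ∧ (∀ᵐ ω ∂μ, (π ω, f ω) ∈ G) ∧
      ∀ B : Set X, MeasurableSet B → ∀ A : Set Y, MeasurableSet A →
        μ (π ⁻¹' A ∩ f ⁻¹' B)
          = α * μ (π ⁻¹' A ∩ f₁ ⁻¹' B) + (1 - α) * μ (π ⁻¹' A ∩ f₂ ⁻¹' B) := by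
  have : Nonempty X := (nonempty_of_isProbabilityMeasure μ).map f₁
  let ρ : Measure (Y × X) :=
    α • μ.map (fun ω ↦ (π ω, f₁ ω)) + (1 - α) • μ.map (fun ω ↦ (π ω, f₂ ω))
  have hρ_apply {s : Set (Y × X)} (hs : MeasurableSet s) :
      ρ s = α * μ {ω | (π ω, f₁ ω) ∈ s} + (1 - α) * μ {ω | (π ω, f₂ ω) ∈ s} := by
    simp only [ρ, Measure.add_apply, Measure.smul_apply, smul_eq_mul]
    rw [Measure.map_apply (hπ.prodMk hf₁) hs, Measure.map_apply (hπ.prodMk hf₂) hs]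
    rfl
  have hρ : ρ.fst = μ.map π := by
    refine Measure.ext fun s hs ↦ ?_
    rw [Measure.fst_apply hs, hρ_apply (measurable_fst hs), Measure.map_apply hπ hs]
    change α * μ (π ⁻¹' s) + (1 - α) * μ (π ⁻¹' s) = _
    rw [← add_mul, add_tsub_cancel_of_le hα, one_mul]
  obtain ⟨f, hf, hfρ⟩ := h.exists_map_prodMk_eq hπ ρ hρ
  have hf_apply {s : Set (Y × X)} (hs : MeasurableSet s) : μ {ω | (π ω, f ω) ∈ s} = ρ s := by
    rw [← hfρ, Measure.map_apply (hπ.prodMk hf) hs]; rfl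
  refine ⟨f, hf, ?_, fun B hB A hA ↦ ?_⟩
  · change μ {ω | (π ω, f ω) ∈ Gᶜ} = 0
    rw [hf_apply hG.compl, hρ_apply hG.compl]
    have h1 : μ {ω | (π ω, f₁ ω) ∈ Gᶜ} = 0 := hf₁G
    have h2 : μ {ω | (π ω, f₂ ω) ∈ Gᶜ} = 0 := hf₂G
    rw [h1, h2, mul_zero, mul_zero, add_zero]
  · exact (hf_apply (hA.prod hB)).trans (hρ_apply (hA.prod hB))

/-- (NE ⇒ B1) If `𝒯` is nowhere equivalent to `ℱ`, then for every sub-σ-algebra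
`𝒢 ⊆ ℱ`, every closed-valued `ℱ`-measurable correspondence `F : T ⇉ X`, every pair
of `𝒯`-measurable selections `f₁, f₂` of `F` and every `α ∈ (0,1)` there is a
`𝒯`-measurable selection `f` of `F` whose RCD given `𝒢` is the `α`-mixture of those
of `f₁` and `f₂`. -/
theorem nowhereEquivalent_implies_convexity
    {T : Type*} [𝒯 : MeasurableSpace T] (μ : Measure T) [IsProbabilityMeasure μ]
    (hcomplete : μ.IsComplete)
    (hatomless : ∀ D : Set T, MeasurableSet[𝒯] D → 0 < μ D →
      ∃ D₀ ⊆ D, MeasurableSet[𝒯] D₀ ∧ 0 < μ D₀ ∧ μ D₀ < μ D)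
    (ℱ : MeasurableSpace T) (hℱ : ℱ ≤ 𝒯)
    {X : Type*} [TopologicalSpace X] [PolishSpace X] [MeasurableSpace X] [BorelSpace X]
    (hNE : ∀ D : Set T, MeasurableSet[𝒯] D → 0 < μ D →
      ∃ D₀ ⊆ D, MeasurableSet[𝒯] D₀ ∧
        ∀ E : Set T, MeasurableSet[ℱ] E → 0 < μ (symmDiff D₀ (D ∩ E))) :
    ∀ 𝒢 : MeasurableSpace T, 𝒢 ≤ ℱ →
      ∀ F : T → Set X,
        MeasurableSet[ℱ.prod inferInstance] {p : T × X | p.2 ∈ F p.1} →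
        (∀ᵐ t ∂μ, IsClosed (F t) ∧ (F t).Nonempty) →
        ∀ f₁ f₂ : T → X, Measurable[𝒯] f₁ → Measurable[𝒯] f₂ →
          (∀ᵐ t ∂μ, f₁ t ∈ F t) → (∀ᵐ t ∂μ, f₂ t ∈ F t) →
          ∀ α : ℝ≥0∞, 0 < α → α < 1 →
            ∃ f : T → X, Measurable[𝒯] f ∧ (∀ᵐ t ∂μ, f t ∈ F t) ∧
              ∀ B : Set X, MeasurableSet B → ∀ A : Set T, MeasurableSet[𝒢] A →
                μ (A ∩ f ⁻¹' B)
                  = α * μ (A ∩ f₁ ⁻¹' B) + (1 - α) * μ (A ∩ f₂ ⁻¹' B) := by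
  intro 𝒢 h𝒢 F hF _ f₁ f₂ hf₁ hf₂ hf₁F hf₂F α _ hα
  obtain ⟨f, hf, hfF, hfα⟩ := @NowhereEquivalentAlong.exists_mixture T T X 𝒯 ℱ _ _ μ _ id hNE
    (fun _ hs ↦ hℱ _ hs) _ hF f₁ f₂ hf₁ hf₂ hf₁F hf₂F α hα.le
  exact ⟨f, hf, hfF, fun B hB A hA ↦ hfα B hB A (h𝒢 A hA)⟩
end

section
/- Let (T, 𝒯, λ) be a complete atomless probability space, ℱ ⊆ 𝒯 a sub-σ-algebra, and X an infinite Polish space. Suppose that for every sub-σ-algebra 𝒢 ⊆ ℱ, every closed-valued ℱ-measurable correspondence F : T ⇉ X, every pair f₁, f₂ of 𝒯-measurable selections of F, and every α ∈ (0,1), there exists a 𝒯-measurable selection f of F with λ(A ∩ f⁻¹(B)) = α·λ(A ∩ f₁⁻¹(B)) + (1−α)·λ(A ∩ f₂⁻¹(B)) for every Borel B ⊆ X and every A ∈ 𝒢 (convexity of the set of regular conditional distributions of selections). Then 𝒯 is nowhere equivalent to ℱ. -/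
open MeasureTheory Set Filter Topology ENNReal

/-- If any two measurable maps have a measurable `α`-mixture conditionally on `m`, then for every
`n` there is a measurable map whose law, conditionally on `m`, is uniform on the `n + 1` points
`x 0, …, x n`. -/
lemma exists_condUniform_of_mixtures {T X : Type*} {m m₀ : MeasurableSpace T} (μ : Measure T)
    [MeasurableSpace X] [MeasurableSingletonClass X] (x : ℕ ↪ X)
    (h : ∀ f₁ f₂ : T → X, Measurable f₁ → Measurable f₂ → ∀ α : ℝ≥0∞, 0 < α → α < 1 →
      ∃ f : T → X, Measurable f ∧ ∀ B : Set X, MeasurableSet B → ∀ A : Set T,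
        MeasurableSet[m] A →
          μ (A ∩ f ⁻¹' B) = α * μ (A ∩ f₁ ⁻¹' B) + (1 - α) * μ (A ∩ f₂ ⁻¹' B)) (n : ℕ) :
    ∃ f : T → X, Measurable f ∧ μ (f ⁻¹' (range x)ᶜ) = 0 ∧ ∀ A, MeasurableSet[m] A →
      ∀ i, μ (A ∩ f ⁻¹' {x i}) = if i ≤ n then ((n : ℝ≥0∞) + 1)⁻¹ * μ A else 0 := by
  induction n with
  | zero =>
    refine ⟨fun _ ↦ x 0, measurable_const, by simp, fun A _ i ↦ ?_⟩
    rcases Nat.eq_zero_or_pos i with rfl | hi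
    · simp
    · have hne : x 0 ≠ x i := fun e ↦ hi.ne (x.injective e)
      simp [hne, hi.ne']
  | succ n ih =>
    obtain ⟨g, hg, hg_range, hgA⟩ := ih
    have h_ne_zero : (n : ℝ≥0∞) + 1 ≠ 0 := by simp
    have h_ne_top : (n : ℝ≥0∞) + 1 ≠ ∞ := by finiteness
    have h_ne_zero' : (n : ℝ≥0∞) + 1 + 1 ≠ 0 := by simp
    have h_ne_top' : (n : ℝ≥0∞) + 1 + 1 ≠ ∞ := by finiteness
    set β : ℝ≥0∞ := ((n : ℝ≥0∞) + 1 + 1)⁻¹ with hβ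
    have hβ_ne_top : β ≠ ∞ := by simp [hβ]
    have h_add : ((n : ℝ≥0∞) + 1) * β + β = 1 := by
      rw [← add_one_mul, hβ, ENNReal.mul_inv_cancel h_ne_zero' h_ne_top']
    have h_sub : 1 - ((n : ℝ≥0∞) + 1) * β = β := by
      conv_lhs => enter [1]; rw [← h_add]
      exact ENNReal.add_sub_cancel_left (by finiteness)
    have hβ_pos : 0 < β := by simp [hβ]
    have h_pos : 0 < ((n : ℝ≥0∞) + 1) * β := ENNReal.mul_pos h_ne_zero hβ_pos.ne'
    have h_lt : ((n : ℝ≥0∞) + 1) * β < 1 := by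
      conv_rhs => rw [← h_add]
      exact ENNReal.lt_add_right (by finiteness) hβ_pos.ne'
    obtain ⟨f, hf, hfA⟩ := h g (fun _ ↦ x (n + 1)) hg measurable_const _ h_pos h_lt
    rw [h_sub] at hfA
    refine ⟨f, hf, ?_, fun A hA i ↦ ?_⟩
    · have := hfA _ (countable_range x).measurableSet.compl univ MeasurableSet.univ
      simpa only [univ_inter, hg_range, mul_zero, zero_add,
        preimage_const_of_notMem (by simp : x (n + 1) ∉ (range x)ᶜ), measure_empty] using this
    · rw [hfA _ (measurableSet_singleton _) A hA, hgA A hA]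
      push_cast
      rw [← hβ]
      rcases lt_trichotomy i (n + 1) with hi | rfl | hi
      · have hne : x (n + 1) ≠ x i := fun e ↦ hi.ne' (x.injective e)
        rw [if_pos (Nat.lt_succ_iff.1 hi), if_pos hi.le,
          preimage_const_of_notMem (by simpa using hne), inter_empty, measure_empty,
          mul_zero, add_zero, mul_right_comm, ← mul_assoc,
          ENNReal.mul_inv_cancel h_ne_zero h_ne_top, one_mul, mul_comm]
      · simp
      · have hne : x (n + 1) ≠ x i := fun e ↦ hi.ne (x.injective e)
        rw [if_neg (by omega), if_neg (by omega), preimage_const_of_notMem (by simpa using hne)]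
        simp

/-- If the trace on `D` of every measurable subset agrees a.e. with the trace of an `m`-measurable
set, and the pieces `S i` cover `D` a.e. and have conditional probability at most `c` given `m`,
then `D` has measure at most `c`. -/
lemma measure_le_of_trace_ae_eq {T : Type*} {m m₀ : MeasurableSpace T} (hm : m ≤ m₀)
    (μ : Measure T) [IsProbabilityMeasure μ] {D : Set T} {S : ℕ → Set T} {c : ℝ≥0∞}
    (hcover : μ (⋃ i, S i)ᶜ = 0)
    (htrace : ∀ i, ∃ E, MeasurableSet[m] E ∧ μ (symmDiff (D ∩ S i) (D ∩ E)) = 0)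
    (hc : ∀ i, ∀ A, MeasurableSet[m] A → μ (A ∩ S i) ≤ c * μ A) : μ D ≤ c := by
  choose E hE hE_zero using htrace
  have hE' : ∀ i, MeasurableSet[m] (disjointed E i) := MeasurableSet.disjointed hE
  set N : Set T := (⋃ i, S i)ᶜ ∪ ⋃ i, symmDiff (D ∩ S i) (D ∩ E i) with hN_def
  have hN : μ N = 0 := measure_union_null hcover (measure_iUnion_null hE_zero)
  have hsub : D ⊆ N ∪ ⋃ i, disjointed E i ∩ S i := by
    intro t ht
    by_cases htN : t ∈ N
    · exact Or.inl htN
    · right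
      simp only [hN_def, mem_union, mem_compl_iff, mem_iUnion, not_or, not_exists,
        mem_symmDiff, mem_inter_iff, ht, true_and] at htN
      obtain ⟨hex, hiff⟩ := htN
      obtain ⟨i, hi⟩ := not_forall_not.1 hex
      have hmem : t ∈ ⋃ j, disjointed E j := by
        rw [iUnion_disjointed]
        exact mem_iUnion.2 ⟨i, by_contra fun hn ↦ (hiff i).1 ⟨hi, hn⟩⟩
      obtain ⟨j, hj⟩ := mem_iUnion.1 hmem
      exact mem_iUnion.2 ⟨j, hj, by_contra fun hn ↦ (hiff j).2 ⟨disjointed_subset E j hj, hn⟩⟩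
  calc μ D ≤ μ N + μ (⋃ i, disjointed E i ∩ S i) :=
        (measure_mono hsub).trans (measure_union_le _ _)
    _ = μ (⋃ i, disjointed E i ∩ S i) := by rw [hN, zero_add]
    _ ≤ ∑' i, μ (disjointed E i ∩ S i) := measure_iUnion_le _
    _ ≤ ∑' i, c * μ (disjointed E i) := ENNReal.tsum_le_tsum fun i ↦ hc i _ (hE' i)
    _ = c * μ (⋃ i, disjointed E i) := by
        rw [ENNReal.tsum_mul_left,
          measure_iUnion (disjoint_disjointed E) fun i ↦ hm _ (hE' i)]
    _ ≤ c := mul_le_of_le_one_right' prob_le_one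

/-- (B1 ⇒ NE) If, for the infinite Polish space `X`, the set of regular conditional
distributions of `𝒯`-measurable selections is convex for every sub-σ-algebra `𝒢 ⊆ ℱ`
and every closed-valued `ℱ`-measurable correspondence `F : T ⇉ X`, then `𝒯` is
nowhere equivalent to `ℱ`. -/
theorem convexity_implies_nowhereEquivalent
    {T : Type*} [𝒯 : MeasurableSpace T] (μ : Measure T) [IsProbabilityMeasure μ]
    (hcomplete : μ.IsComplete)
    (hatomless : ∀ D : Set T, MeasurableSet[𝒯] D → 0 < μ D →
      ∃ D₀ ⊆ D, MeasurableSet[𝒯] D₀ ∧ 0 < μ D₀ ∧ μ D₀ < μ D)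
    (ℱ : MeasurableSpace T) (hℱ : ℱ ≤ 𝒯)
    {X : Type*} [TopologicalSpace X] [PolishSpace X] [MeasurableSpace X] [BorelSpace X]
    [Infinite X]
    (hB1 : ∀ 𝒢 : MeasurableSpace T, 𝒢 ≤ ℱ →
      ∀ F : T → Set X,
        MeasurableSet[ℱ.prod inferInstance] {p : T × X | p.2 ∈ F p.1} →
        (∀ᵐ t ∂μ, IsClosed (F t) ∧ (F t).Nonempty) →
        ∀ f₁ f₂ : T → X, Measurable[𝒯] f₁ → Measurable[𝒯] f₂ →
          (∀ᵐ t ∂μ, f₁ t ∈ F t) → (∀ᵐ t ∂μ, f₂ t ∈ F t) →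
          ∀ α : ℝ≥0∞, 0 < α → α < 1 →
            ∃ f : T → X, Measurable[𝒯] f ∧ (∀ᵐ t ∂μ, f t ∈ F t) ∧
              ∀ B : Set X, MeasurableSet B → ∀ A : Set T, MeasurableSet[𝒢] A →
                μ (A ∩ f ⁻¹' B)
                  = α * μ (A ∩ f₁ ⁻¹' B) + (1 - α) * μ (A ∩ f₂ ⁻¹' B)) :
    ∀ D : Set T, MeasurableSet[𝒯] D → 0 < μ D →
      ∃ D₀ ⊆ D, MeasurableSet[𝒯] D₀ ∧
        ∀ E : Set T, MeasurableSet[ℱ] E → 0 < μ (symmDiff D₀ (D ∩ E)) := by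
  intro D hD hD_pos
  by_contra! hcon
  have hmix := hB1 ℱ le_rfl (fun _ ↦ univ) (by simp) (by simp)
  obtain ⟨n, hn⟩ := ENNReal.exists_inv_nat_lt hD_pos.ne'
  obtain ⟨f, hf, hf_range, hfA⟩ := exists_condUniform_of_mixtures (m := ℱ) μ
    (Infinite.natEmbedding X) (fun f₁ f₂ hf₁ hf₂ α hα₀ hα₁ ↦ by
      obtain ⟨f, hf, -, hfB⟩ := hmix f₁ f₂ hf₁ hf₂ (by simp) (by simp) α hα₀ hα₁
      exact ⟨f, hf, hfB⟩) n
  have hle : μ D ≤ (n : ℝ≥0∞)⁻¹ := by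
    refine measure_le_of_trace_ae_eq hℱ μ (S := fun i ↦ f ⁻¹' {Infinite.natEmbedding X i})
      ?_ (fun i ↦ ?_) fun i A hA ↦ ?_
    · rwa [← preimage_iUnion, iUnion_singleton_eq_range, ← preimage_compl]
    · obtain ⟨E, hE, hE_zero⟩ := hcon _ inter_subset_left
        (MeasurableSet.inter (m := 𝒯) hD (hf (measurableSet_singleton _)))
      exact ⟨E, hE, nonpos_iff_eq_zero.1 hE_zero⟩
    · rw [hfA A hA i]
      split_ifs
      · gcongr
        exact le_self_add
      · exact zero_le
  exact absurd hle hn.not_ge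
end

section
/- Let X be a Polish space, Z a topological space, and G an open subset of X × Z. Let (μ_α) be a net of Borel probability measures on X converging weakly to a Borel probability measure μ, and let (z_α) be a net in Z (over the same directed index set) converging to z. Then liminf_α μ_α(G_{z_α}) ≥ μ(G_z), where for A ⊆ X × Z and w ∈ Z, A_w := {x ∈ X : (x,w) ∈ A} denotes the section of A at w. -/
open MeasureTheory Set Filter Topology ENNReal

/-- Portmanteau-type lemma along a net: if `G ⊆ X × Z` is open, `μ_α ⇒ μ` weakly and
`z_α → z`, then `liminf_α μ_α(G_{z_α}) ≥ μ(G_z)`. -/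
theorem liminf_measure_open_section_ge
    {X : Type*} [TopologicalSpace X] [PolishSpace X] [MeasurableSpace X] [BorelSpace X]
    {Z : Type*} [TopologicalSpace Z]
    {ι : Type*} (l : Filter ι) [l.NeBot]
    (G : Set (X × Z)) (hG : IsOpen G)
    (μs : ι → ProbabilityMeasure X) (μ : ProbabilityMeasure X)
    (hμ : Tendsto μs l (𝓝 μ))
    (z : ι → Z) (z₀ : Z) (hz : Tendsto z l (𝓝 z₀)) :
    (μ : Measure X) {x : X | (x, z₀) ∈ G}
      ≤ l.liminf fun i => (μs i : Measure X) {x : X | (x, z i) ∈ G} := by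
  have hsec : IsOpen {x : X | (x, z₀) ∈ G} := hG.preimage (by fun_prop)
  refine le_of_forall_lt fun r hr => ?_
  obtain ⟨K, hKG, hK, hrK⟩ := hsec.measurableSet.exists_lt_isCompact_of_ne_top
    (measure_ne_top (μ : Measure X) _) hr
  obtain ⟨U, V, hU, hV, hKU, hzV, hUV⟩ := generalized_tube_lemma hK
    (isCompact_singleton (x := z₀)) hG (by rintro ⟨x, w⟩ ⟨hx, rfl⟩; exact hKG hx)
  calc r < (μ : Measure X) K := hrK
    _ ≤ (μ : Measure X) U := measure_mono hKU
    _ ≤ l.liminf fun i => (μs i : Measure X) U :=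
      ProbabilityMeasure.le_liminf_measure_open_of_tendsto hμ hU
    _ ≤ _ := by
      refine liminf_le_liminf ?_
      filter_upwards [hz (hV.mem_nhds (hzV rfl))] with i hi
      exact measure_mono fun x hx => hUV ⟨hx, hi⟩
end

section
/- Let X be a Polish space, Z a topological space, and F a closed subset of X × Z. Let (μ_α) be a net of Borel probability measures on X converging weakly to a Borel probability measure μ, and let (z_α) be a net in Z (over the same directed index set) converging to z. Then limsup_α μ_α(F_{z_α}) ≤ μ(F_z), where for A ⊆ X × Z and w ∈ Z, A_w := {x ∈ X : (x,w) ∈ A} denotes the section of A at w. -/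
open MeasureTheory Set Filter Topology ENNReal

/-- In a second countable space, a finite Borel measure is continuous from above along an
arbitrary (possibly uncountable) directed family of closed sets. -/
theorem measure_iInter_eq_iInf_of_directed_isClosed
    {X : Type*} [TopologicalSpace X] [SecondCountableTopology X] [MeasurableSpace X]
    [OpensMeasurableSpace X] (μ : Measure X) [IsFiniteMeasure μ]
    {κ : Type*} [Nonempty κ] {s : κ → Set X} (hs : ∀ k, IsClosed (s k))
    (hd : Directed (· ⊇ ·) s) :
    μ (⋂ k, s k) = ⨅ k, μ (s k) := by
  classical
  refine le_antisymm (le_iInf fun k => measure_mono (iInter_subset _ _)) ?_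
  obtain ⟨T, hTc, hT⟩ := TopologicalSpace.isOpen_iUnion_countable (fun k => (s k)ᶜ)
    fun k => (hs k).isOpen_compl
  obtain ⟨f, hf⟩ := (hTc.insert (Classical.arbitrary κ)).exists_eq_range (insert_nonempty _ _)
  have hsub : ⋂ n, s (f n) ⊆ ⋂ k, s k := by
    rw [← compl_subset_compl, compl_iInter, compl_iInter, ← hT]
    refine iUnion₂_subset fun k hk => ?_
    obtain ⟨n, rfl⟩ : k ∈ range f := hf ▸ mem_insert_of_mem _ hk
    exact subset_iUnion (fun n => (s (f n))ᶜ) n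
  calc ⨅ k, μ (s k) ≤ ⨅ n, μ (⋂ j ≤ n, s (f j)) := by
        refine le_iInf fun n => ?_
        obtain ⟨k, hk⟩ := hd.finset_le ((Finset.range (n + 1)).image f)
        refine (iInf_le _ k).trans (measure_mono (subset_iInter₂ fun j hj => hk _ ?_))
        exact Finset.mem_image_of_mem _ (Finset.mem_range.2 (Nat.lt_succ_of_le hj))
    _ = μ (⋂ n, s (f n)) :=
        (measure_iInter_eq_iInf_measure_iInter_le
          (fun n => (hs (f n)).measurableSet.nullMeasurableSet) ⟨0, measure_ne_top _ _⟩).symm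
    _ ≤ μ (⋂ k, s k) := measure_mono hsub

/-- The section at `z₀` of a closed set `F` is the intersection, over the neighborhoods `U` of
`z₀`, of the closures of the projections of `F ∩ (X × U)`. -/
theorem IsClosed.iInter_closure_sections_eq
    {X Z : Type*} [TopologicalSpace X] [TopologicalSpace Z] {F : Set (X × Z)} (hF : IsClosed F)
    (z₀ : Z) :
    ⋂ U : {U : Set Z // U ∈ 𝓝 z₀}, closure {x : X | ∃ w ∈ U.1, (x, w) ∈ F}
      = {x : X | (x, z₀) ∈ F} := by
  ext x
  simp only [mem_iInter, mem_ofPred_eq]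
  constructor
  · intro h
    rw [← hF.closure_eq, mem_closure_iff_nhds]
    intro t ht
    obtain ⟨V, hV, U, hU, hVU⟩ := mem_nhds_prod_iff.1 ht
    obtain ⟨y, hyV, w, hwU, hyw⟩ := mem_closure_iff_nhds.1 (h ⟨U, hU⟩) V hV
    exact ⟨(y, w), hVU ⟨hyV, hwU⟩, hyw⟩
  · exact fun h U => subset_closure ⟨z₀, mem_of_mem_nhds U.2, h⟩

/-- Portmanteau-type lemma along a net: if `F ⊆ X × Z` is closed, `μ_α ⇒ μ` weakly and
`z_α → z`, then `limsup_α μ_α(F_{z_α}) ≤ μ(F_z)`. -/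
theorem limsup_measure_closed_section_le
    {X : Type*} [TopologicalSpace X] [PolishSpace X] [MeasurableSpace X] [BorelSpace X]
    {Z : Type*} [TopologicalSpace Z]
    {ι : Type*} (l : Filter ι) [l.NeBot]
    (F : Set (X × Z)) (hF : IsClosed F)
    (μs : ι → ProbabilityMeasure X) (μ : ProbabilityMeasure X)
    (hμ : Tendsto μs l (𝓝 μ))
    (z : ι → Z) (z₀ : Z) (hz : Tendsto z l (𝓝 z₀)) :
    l.limsup (fun i => (μs i : Measure X) {x : X | (x, z i) ∈ F})
      ≤ (μ : Measure X) {x : X | (x, z₀) ∈ F} := by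
  have : Nonempty {U : Set Z // U ∈ 𝓝 z₀} := ⟨⟨univ, univ_mem⟩⟩
  rw [← hF.iInter_closure_sections_eq z₀,
    measure_iInter_eq_iInf_of_directed_isClosed _ (fun _ => isClosed_closure)]
  · refine le_iInf fun U => ?_
    refine le_trans (limsup_le_limsup ?_)
      (ProbabilityMeasure.limsup_measure_closed_le_of_tendsto hμ isClosed_closure)
    filter_upwards [hz U.2] with i hi
    exact measure_mono fun x hx => subset_closure ⟨z i, hi, hx⟩
  · intro U V
    refine ⟨⟨U.1 ∩ V.1, inter_mem U.2 V.2⟩, closure_mono ?_, closure_mono ?_⟩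
    · exact fun x ⟨w, hw, hx⟩ => ⟨w, hw.1, hx⟩
    · exact fun x ⟨w, hw, hx⟩ => ⟨w, hw.2, hx⟩
end

section
/- Let (T, 𝒯, λ) be a complete probability space, ℱ ⊆ 𝒯 a sub-σ-algebra, and X a Polish space. Let F : T ⇉ X be a closed-valued ℱ-measurable correspondence, let f₁, f₂ be 𝒯-measurable selections of F, let α ∈ (0,1), and let f : T → X be a 𝒯-measurable map such that for every Borel B ⊆ X and every A ∈ ℱ, λ(A ∩ f⁻¹(B)) = α·λ(A ∩ f₁⁻¹(B)) + (1−α)·λ(A ∩ f₂⁻¹(B)). Then f(t) ∈ F(t) for λ-almost every t; that is, f is itself a 𝒯-measurable selection of F. -/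
open MeasureTheory Set Filter Topology ENNReal

/-- If the joint law of `(g, f)` is a linear combination of those of `(g, f₁)` and `(g, f₂)`
on rectangles, then any measurable relation between `g` and `f₁`, and between `g` and `f₂`,
holds between `g` and `f`. -/
theorem ae_mem_of_mixture_on_rectangles {T S X : Type*} [MeasurableSpace T] [MeasurableSpace S]
    [MeasurableSpace X] (μ : Measure T) [IsFiniteMeasure μ] {g : T → S} (hg : Measurable g)
    {f f₁ f₂ : T → X} (hf : Measurable f) (hf₁ : Measurable f₁) (hf₂ : Measurable f₂)
    {a b : ℝ≥0∞} {G : Set (S × X)} (hG : MeasurableSet G)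
    (h₁ : ∀ᵐ t ∂μ, (g t, f₁ t) ∈ G) (h₂ : ∀ᵐ t ∂μ, (g t, f₂ t) ∈ G)
    (hmix : ∀ A : Set S, MeasurableSet A → ∀ B : Set X, MeasurableSet B →
      μ (g ⁻¹' A ∩ f ⁻¹' B) = a * μ (g ⁻¹' A ∩ f₁ ⁻¹' B) + b * μ (g ⁻¹' A ∩ f₂ ⁻¹' B)) :
    ∀ᵐ t ∂μ, (g t, f t) ∈ G := by
  have hlaw : μ.map (fun t ↦ (g t, f t)) =
      a • μ.map (fun t ↦ (g t, f₁ t)) + b • μ.map (fun t ↦ (g t, f₂ t)) := by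
    refine Measure.ext_prod fun {A B} hA hB ↦ ?_
    rw [Measure.add_apply, Measure.smul_apply, Measure.smul_apply,
      Measure.map_apply (hg.prodMk hf) (hA.prod hB),
      Measure.map_apply (hg.prodMk hf₁) (hA.prod hB),
      Measure.map_apply (hg.prodMk hf₂) (hA.prod hB)]
    exact hmix A hA B hB
  rw [← ae_map_iff (p := (· ∈ G)) (hg.prodMk hf).aemeasurable hG, hlaw,
    ae_add_measure_iff]
  exact ⟨Measure.ae_smul_measure ((ae_map_iff (hg.prodMk hf₁).aemeasurable hG).2 h₁) a,
    Measure.ae_smul_measure ((ae_map_iff (hg.prodMk hf₂).aemeasurable hG).2 h₂) b⟩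

/-- If `f` is a `𝒯`-measurable map whose RCD given `ℱ` is the `α`-mixture of the RCDs
of two `𝒯`-measurable selections `f₁, f₂` of a closed-valued `ℱ`-measurable
correspondence `F`, then `f` is itself a selection of `F`, i.e. `f t ∈ F t` a.e. -/
theorem mixture_rcd_is_selection
    {T : Type*} [𝒯 : MeasurableSpace T] (μ : Measure T) [IsProbabilityMeasure μ]
    (hcomplete : μ.IsComplete)
    (ℱ : MeasurableSpace T) (hℱ : ℱ ≤ 𝒯)
    {X : Type*} [TopologicalSpace X] [PolishSpace X] [MeasurableSpace X] [BorelSpace X]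
    (F : T → Set X)
    (hgraph : MeasurableSet[ℱ.prod inferInstance] {p : T × X | p.2 ∈ F p.1})
    (hclosed : ∀ᵐ t ∂μ, IsClosed (F t) ∧ (F t).Nonempty)
    (f₁ f₂ : T → X) (hf₁ : Measurable[𝒯] f₁) (hf₂ : Measurable[𝒯] f₂)
    (hsel₁ : ∀ᵐ t ∂μ, f₁ t ∈ F t) (hsel₂ : ∀ᵐ t ∂μ, f₂ t ∈ F t)
    (α : ℝ≥0∞) (hα0 : 0 < α) (hα1 : α < 1)
    (f : T → X) (hf : Measurable[𝒯] f)
    (hmix : ∀ B : Set X, MeasurableSet B → ∀ A : Set T, MeasurableSet[ℱ] A →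
      μ (A ∩ f ⁻¹' B) = α * μ (A ∩ f₁ ⁻¹' B) + (1 - α) * μ (A ∩ f₂ ⁻¹' B)) :
    ∀ᵐ t ∂μ, f t ∈ F t := by
  exact @ae_mem_of_mixture_on_rectangles T T X 𝒯 ℱ _ μ _ id (measurable_id'' hℱ)
    f f₁ f₂ hf hf₁ hf₂ α (1 - α) _ hgraph hsel₁ hsel₂ fun A hA B hB ↦ hmix B hB A hA
end

section
/- Let (T, 𝒯, λ) be a complete atomless probability space and ℱ ⊆ 𝒯 a sub-σ-algebra such that 𝒯 is nowhere equivalent to ℱ. Let A be a nonempty compact metric space, let 𝓜(A) denote the space of Borel probability measures on A with the topology of weak convergence, and let v : T → C_b(A × 𝓜(A)) be a strongly ℱ-measurable map into the Banach space of bounded continuous real-valued functions on A × 𝓜(A) with the supremum norm. Then there exists a 𝒯-measurable function f : T → A such that for λ-almost every t ∈ T, v(t)(f(t), λ ∘ f⁻¹) ≥ v(t)(a, λ ∘ f⁻¹) for all a ∈ A, where λ ∘ f⁻¹ ∈ 𝓜(A) is the pushforward law of f. (This is the existence of a pure-strategy Nash equilibrium in a large anonymous game, i.e., the case of a one-point trait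 space.) -/
open MeasureTheory Set Filter Topology ENNReal

section Dominance

variable {X I L : Type*} [LinearOrder L]

/-- `C` is dominant for the indices `J` if every point lies below all of `C` in some order
`r j`, `j ∈ J`. -/
def IsDominant (r : I → X → L) (C : Finset X) (J : Finset I) : Prop :=
  ∀ y, ∃ j ∈ J, ∀ x ∈ C, r j y ≤ r j x

theorem IsDominant.mono {r : I → X → L} {C C' : Finset X} {J J' : Finset I}
    (h : IsDominant r C J) (hC : C' ⊆ C) (hJ : J ⊆ J') : IsDominant r C' J' := fun y ↦ by
  obtain ⟨j, hj, h'⟩ := h y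
  exact ⟨j, hJ hj, fun x hx ↦ h' x (hC hx)⟩

theorem IsDominant.image_eq [DecidableEq X] {r : I → X → L} (hr : ∀ i, Function.Injective (r i))
    {C : Finset X} {J : Finset I} (h : IsDominant r C J) {m : I → X}
    (hm : ∀ j, m j ∈ C) (hm' : ∀ j, ∀ z ∈ C, r j (m j) ≤ r j z) : J.image m = C := by
  ext x
  simp only [Finset.mem_image]
  constructor
  · rintro ⟨j, -, rfl⟩
    exact hm j
  · intro hx
    obtain ⟨j, hj, h'⟩ := h x
    exact ⟨j, hj, hr j (le_antisymm (hm' j x hx) (h' _ (hm j)))⟩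

theorem exists_min_map (r : I → X → L) {C : Finset X} (hC : C.Nonempty) :
    ∃ m : I → X, (∀ j, m j ∈ C) ∧ ∀ j, ∀ z ∈ C, r j (m j) ≤ r j z := by
  choose m hm hm' using fun j ↦ C.exists_min_image (r j) hC
  exact ⟨m, hm, hm'⟩

/-- In a set of indices with exactly one repetition, there are exactly two indices whose removal
leaves the image unchanged. -/
theorem exists_pair_image_erase [DecidableEq X] [DecidableEq I] {m : I → X} {D : Finset I}
    (hcard : D.card = (D.image m).card + 1) :
    ∃ a ∈ D, ∃ b ∈ D, a ≠ b ∧ (D.erase a).image m = D.image m ∧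
      (D.erase b).image m = D.image m ∧
      ∀ e ∈ D, (D.erase e).image m = D.image m → e = a ∨ e = b := by
  obtain ⟨a, ha, b, hb, hab, hm⟩ := Finset.exists_ne_map_eq_of_card_lt_of_maps_to
    (s := D) (t := D.image m) (by omega) (f := m) (fun x hx ↦ Finset.mem_image_of_mem m hx)
  refine ⟨a, ha, b, hb, hab, ?_, ?_, ?_⟩
  · ext x; simp only [Finset.mem_image, Finset.mem_erase]; grind
  · ext x; simp only [Finset.mem_image, Finset.mem_erase]; grind
  · intro e he h
    by_contra! hne
    have hinj : Set.InjOn m (D.erase e) := by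
      rw [← Finset.card_image_iff, h, Finset.card_erase_of_mem he]; omega
    exact hab (hinj (by simp [ha, hne.1.symm]) (by simp [hb, hne.2.symm]) hm)

open Classical in
/-- Dominant pairs of equal size. -/
noncomputable def rooms [Fintype X] [Fintype I] (r : I → X → L) : Finset (Finset X × Finset I) :=
  {R | IsDominant r R.1 R.2 ∧ R.1.card = R.2.card}

open Classical in
/-- Dominant pairs `(τ, D)` with `D` one larger than `τ`, coloured by all of `D` except `i`. -/
noncomputable def doors [Fintype X] [Fintype I] (r : I → X → L) (c : X → I) (i : I) : Finset (Finset X × Finset I) :=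
  {R | IsDominant r R.1 R.2 ∧ R.2.card = R.1.card + 1 ∧ i ∈ R.2 ∧ R.1.image c = R.2.erase i}

/-- Incidence between doors and rooms. -/
def DoorOf (d R : Finset X × Finset I) : Prop := d.1 ⊆ R.1 ∧ R.2 ⊆ d.2

theorem DoorOf.cases [DecidableEq X] [DecidableEq I] {d R : Finset X × Finset I} (h : DoorOf d R)
    (hd : d.2.card = d.1.card + 1) (hR : R.1.card = R.2.card) :
    (d.1 = R.1 ∧ ∃ j ∈ d.2, R.2 = d.2.erase j) ∨
      (d.2 = R.2 ∧ ∃ x ∈ R.1, d.1 = R.1.erase x) := by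
  have h1 := Finset.card_le_card h.1
  have h2 := Finset.card_le_card h.2
  rcases eq_or_lt_of_le h1 with h3 | h3
  · left
    refine ⟨Finset.eq_of_subset_of_card_le h.1 h3.ge, ?_⟩
    have h4 : (d.2 \ R.2).card = 1 := by rw [Finset.card_sdiff_of_subset h.2]; omega
    obtain ⟨j, hj⟩ := Finset.card_eq_one.1 h4
    have hj' : j ∈ d.2 \ R.2 := by simp [hj]
    refine ⟨j, (Finset.mem_sdiff.1 hj').1, ?_⟩
    rw [← Finset.sdiff_singleton_eq_erase, ← hj, Finset.sdiff_sdiff_eq_self h.2]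
  · right
    have h5 : R.2.card = d.2.card := by omega
    refine ⟨(Finset.eq_of_subset_of_card_le h.2 h5.ge).symm, ?_⟩
    have h4 : (R.1 \ d.1).card = 1 := by rw [Finset.card_sdiff_of_subset h.1]; omega
    obtain ⟨j, hj⟩ := Finset.card_eq_one.1 h4
    have hj' : j ∈ R.1 \ d.1 := by simp [hj]
    refine ⟨j, (Finset.mem_sdiff.1 hj').1, ?_⟩
    rw [← Finset.sdiff_singleton_eq_erase, ← hj, Finset.sdiff_sdiff_eq_self h.1]

open Classical in
theorem card_rooms_of_empty_door [Fintype X] [Fintype I] [Nonempty X] {r : I → X → L}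
    (hr : ∀ i, Function.Injective (r i)) (i : I) :
    ((rooms r).filter (fun R ↦ DoorOf (∅, {i}) R)).card = 1 := by
  obtain ⟨x, -, hx⟩ := Finset.exists_max_image Finset.univ (r i) Finset.univ_nonempty
  rw [Finset.card_eq_one]
  refine ⟨({x}, {i}), ?_⟩
  ext ⟨σ, C⟩
  simp only [rooms, Finset.mem_filter, Finset.mem_univ, true_and, Finset.mem_singleton, DoorOf,
    Prod.mk.injEq, Finset.empty_subset, Finset.subset_singleton_iff]
  constructor
  · rintro ⟨⟨hd, hc⟩, h⟩
    have hC : C = {i} := by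
      rcases h with rfl | rfl
      · obtain ⟨j, hj, -⟩ := hd x
        simp at hj
      · rfl
    subst hC
    refine ⟨?_, rfl⟩
    obtain ⟨y, rfl⟩ := Finset.card_eq_one.1 (hc.trans (by simp))
    obtain ⟨j, hj, h'⟩ := hd x
    simp only [Finset.mem_singleton] at hj h'
    subst hj
    rw [hr j (le_antisymm (h' y rfl) (hx y (Finset.mem_univ _)))]
  · rintro ⟨rfl, rfl⟩
    refine ⟨⟨fun y ↦ ⟨i, by simp, by simpa using hx y (Finset.mem_univ _)⟩, by simp⟩, by simp⟩

open Classical in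
theorem existsUnique_room [Fintype X] [Fintype I] {r : I → X → L} (hr : ∀ i, Function.Injective (r i))
    {τ : Finset X} {D : Finset I} (hd : IsDominant r τ D) (hcard : D.card = τ.card + 1)
    {m : I → X} (hm' : ∀ j, ∀ z ∈ τ, r j (m j) ≤ r j z)
    {e : I} (he : e ∈ D) (him : (D.erase e).image m = τ) :
    ∃! R : Finset X × Finset I, R ∈ rooms r ∧
      (R = (τ, D.erase e) ∨ ∃ x, (∀ j ∈ D.erase e, ∃ z ∈ τ, r j z < r j x) ∧
        R = (insert x τ, D)) := by
  set M : Finset X := {x | ∀ j ∈ D.erase e, ∃ z ∈ τ, r j z < r j x} with hM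
  have memM : ∀ x, x ∈ M ↔ ∀ j ∈ D.erase e, ∃ z ∈ τ, r j z < r j x := by simp [hM]
  have hdom : IsDominant r τ (D.erase e) ↔ M = ∅ := by
    rw [Finset.eq_empty_iff_forall_notMem]
    refine forall_congr' fun y ↦ ?_
    rw [memM]; push Not; rfl
  have hnot : ∀ x ∈ M, x ∉ τ := by
    intro x hx hxτ
    rw [← him, Finset.mem_image] at hxτ
    obtain ⟨j, hj, rfl⟩ := hxτ
    obtain ⟨z, hz, hlt⟩ := (memM _).1 hx j hj
    exact absurd (hm' j z hz) (not_le.2 hlt)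
  by_cases hMe : M = ∅
  · refine ⟨(τ, D.erase e), ⟨?_, Or.inl rfl⟩, ?_⟩
    · simp only [rooms, Finset.mem_filter, Finset.mem_univ, true_and, hdom, hMe,
        Finset.card_erase_of_mem he]
      omega
    · rintro R ⟨-, h | ⟨x, hx, -⟩⟩
      · exact h
      · have := (memM x).2 hx
        simp [hMe] at this
  · obtain ⟨x, hxM, hx⟩ := Finset.exists_max_image M (r e) (Finset.nonempty_iff_ne_empty.2 hMe)
    have key : ∀ y ∈ M, ∀ z ∈ τ, r e y ≤ r e z := by
      intro y hy
      obtain ⟨j, hj, h⟩ := hd y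
      by_cases hje : j = e
      · exact hje ▸ h
      · obtain ⟨z, hz, hlt⟩ := (memM y).1 hy j (Finset.mem_erase.2 ⟨hje, hj⟩)
        exact absurd (h z hz) (not_le.2 hlt)
    refine ⟨(insert x τ, D), ⟨?_, Or.inr ⟨x, (memM x).1 hxM, rfl⟩⟩, ?_⟩
    · simp only [rooms, Finset.mem_filter, Finset.mem_univ, true_and,
        Finset.card_insert_of_notMem (hnot x hxM), hcard, and_true]
      intro y
      by_cases hy : y ∈ M
      · exact ⟨e, he, by simpa using ⟨hx y hy, key y hy⟩⟩
      · rw [memM] at hy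
        push Not at hy
        obtain ⟨j, hj, hy⟩ := hy
        obtain ⟨z, hz, hlt⟩ := (memM x).1 hxM j hj
        exact ⟨j, Finset.mem_of_mem_erase hj, by
          simpa using ⟨(hy z hz).trans hlt.le, hy⟩⟩
    · rintro R ⟨hR, rfl | ⟨y, hy, rfl⟩⟩
      · simp only [rooms, Finset.mem_filter, Finset.mem_univ, true_and] at hR
        exact absurd (hdom.1 hR.1) hMe
      · simp only [rooms, Finset.mem_filter, Finset.mem_univ, true_and] at hR
        have hyM := (memM y).2 hy
        obtain ⟨j, hj, h⟩ := hR.1 x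
        simp only [Finset.mem_insert, forall_eq_or_imp] at h
        have hje : j = e := by
          by_contra hje
          obtain ⟨z, hz, hlt⟩ := (memM x).1 hxM j (Finset.mem_erase.2 ⟨hje, hj⟩)
          exact absurd (h.2 z hz) (not_le.2 hlt)
        subst hje
        rw [hr j (le_antisymm h.1 (hx y hyM))]

open Classical in
theorem card_rooms_of_door [Fintype X] [Fintype I] {r : I → X → L} (hr : ∀ i, Function.Injective (r i))
    {τ : Finset X} {D : Finset I} (hτ : τ.Nonempty) (hd : IsDominant r τ D)
    (hcard : D.card = τ.card + 1) :
    ((rooms r).filter (fun R ↦ DoorOf (τ, D) R)).card = 2 := by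
  obtain ⟨m, hm, hm'⟩ := exists_min_map r hτ
  have him := hd.image_eq hr hm hm'
  obtain ⟨a, ha, b, hb, hab, hia, hib, hmax⟩ := exists_pair_image_erase (m := m) (D := D)
    (by rw [him, hcard])
  rw [him] at hia hib hmax
  obtain ⟨Ra, ⟨hRa, hRa'⟩, hRau⟩ := existsUnique_room hr hd hcard hm' ha hia
  obtain ⟨Rb, ⟨hRb, hRb'⟩, hRbu⟩ := existsUnique_room hr hd hcard hm' hb hib
  rw [Finset.card_eq_two]
  refine ⟨Ra, Rb, ?_, ?_⟩
  · rintro rfl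
    rcases hRa' with h | ⟨x, hx, h⟩ <;> rcases hRb' with h' | ⟨y, hy, h'⟩
    · have h2 : D.erase a = D.erase b := congrArg Prod.snd (h.symm.trans h')
      have : b ∈ D.erase b := h2 ▸ Finset.mem_erase.2 ⟨hab.symm, hb⟩
      simp at this
    · have h2 : D.erase a = D := congrArg Prod.snd (h.symm.trans h')
      exact Finset.notMem_erase a D (h2.symm ▸ ha)
    · have h2 : D = D.erase b := congrArg Prod.snd (h.symm.trans h')
      exact Finset.notMem_erase b D (h2 ▸ hb)
    · have h1 : insert x τ = insert y τ := congrArg Prod.fst (h.symm.trans h')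
      have hcR : (insert x τ).card = τ.card + 1 := by
        simp only [rooms, Finset.mem_filter, Finset.mem_univ, true_and] at hRa
        have := hRa.2
        rw [h] at this
        simpa [hcard] using this
      have hxτ : x ∉ τ := fun hx' ↦ by rw [Finset.insert_eq_of_mem hx'] at hcR; omega
      have hxy : x = y := by
        have : x ∈ insert y τ := h1 ▸ Finset.mem_insert_self x τ
        exact (Finset.mem_insert.1 this).resolve_right hxτ
      subst hxy
      obtain ⟨j, hj, hdj⟩ := hd x
      have : ∃ z ∈ τ, r j z < r j x := by
        by_cases hja : j = a
        · exact hy j (Finset.mem_erase.2 ⟨by rw [hja]; exact hab, hj⟩)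
        · exact hx j (Finset.mem_erase.2 ⟨hja, hj⟩)
      obtain ⟨z, hz, hlt⟩ := this
      exact absurd (hdj z hz) (not_le.2 hlt)
  · have hsub : ∀ e ∈ D, ∀ R, (R = (τ, D.erase e) ∨
        ∃ x, (∀ j ∈ D.erase e, ∃ z ∈ τ, r j z < r j x) ∧ R = (insert x τ, D)) →
        DoorOf (τ, D) R := by
      rintro e he R (rfl | ⟨x, -, rfl⟩)
      · exact ⟨subset_rfl, Finset.erase_subset _ _⟩
      · exact ⟨Finset.subset_insert _ _, subset_rfl⟩
    ext R
    simp only [Finset.mem_filter, Finset.mem_insert, Finset.mem_singleton]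
    constructor
    · rintro ⟨hR, hdR⟩
      have hR' := hR
      simp only [rooms, Finset.mem_filter, Finset.mem_univ, true_and] at hR'
      obtain ⟨hRd, hRc⟩ := hR'
      obtain ⟨σ, C⟩ := R
      rcases hdR.cases hcard hRc with ⟨h1, e, he, h2⟩ | ⟨h1, x, hx, h2⟩
      · simp only at h1 h2 hRd he
        subst h1 h2
        rcases hmax e he (hRd.image_eq hr hm hm') with rfl | rfl
        · exact Or.inl (hRau _ ⟨hR, Or.inl rfl⟩)
        · exact Or.inr (hRbu _ ⟨hR, Or.inl rfl⟩)
      · simp only at h1 h2 hRd hx hRc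
        subst h1
        have hσ : σ = insert x τ := by rw [h2, Finset.insert_erase hx]
        have hxτ : x ∉ τ := by rw [h2]; simp
        obtain ⟨m₂, hm₂, hm₂'⟩ := exists_min_map r (C := σ) ⟨x, hx⟩
        have him₂ := hRd.image_eq hr hm₂ hm₂'
        have hinj : Set.InjOn m₂ D := by
          rw [← Finset.card_image_iff, him₂, hRc]
        obtain ⟨e, he, hex⟩ := Finset.mem_image.1 (him₂.symm ▸ hx : x ∈ D.image m₂)
        have heq : ∀ j ∈ D.erase e, m₂ j = m j := by
          intro j hj
          have hjx : m₂ j ≠ x := fun h ↦ (Finset.mem_erase.1 hj).1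
            (hinj (Finset.mem_of_mem_erase hj) he (h.trans hex.symm))
          have hjτ : m₂ j ∈ τ := by
            have := hm₂ j
            rw [hσ] at this
            exact (Finset.mem_insert.1 this).resolve_left hjx
          refine hr j (le_antisymm (hm₂' j _ ?_) (hm' j _ hjτ))
          rw [hσ]
          exact Finset.mem_insert_of_mem (hm j)
        have hime : (D.erase e).image m = τ := by
          rw [← Finset.image_congr (f := m₂) (fun j hj ↦ heq j hj)]
          rw [h2, ← him₂, ← hex]
          ext z
          simp only [Finset.mem_image, Finset.mem_erase]
          constructor
          · rintro ⟨j, ⟨hje, hj⟩, rfl⟩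
            exact ⟨fun h ↦ hje (hinj hj he h), j, hj, rfl⟩
          · rintro ⟨hz, j, hj, rfl⟩
            exact ⟨j, ⟨fun h ↦ hz (h ▸ rfl), hj⟩, rfl⟩
        have hxM : ∀ j ∈ D.erase e, ∃ z ∈ τ, r j z < r j x := by
          intro j hj
          refine ⟨m j, hm j, lt_of_le_of_ne ?_ ?_⟩
          · rw [← heq j hj]; exact hm₂' j x hx
          · exact fun h ↦ hxτ (hr j h ▸ hm j)
        rcases hmax e he hime with rfl | rfl
        · exact Or.inl (hRau _ ⟨hR, Or.inr ⟨x, hxM, by rw [hσ]⟩⟩)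
        · exact Or.inr (hRbu _ ⟨hR, Or.inr ⟨x, hxM, by rw [hσ]⟩⟩)
    · rintro (rfl | rfl)
      · exact ⟨hRa, hsub a ha _ hRa'⟩
      · exact ⟨hRb, hsub b hb _ hRb'⟩

open Classical in
theorem mem_doors_of_room [Fintype X] [Fintype I] {r : I → X → L} {c : X → I} {i : I} {R : Finset X × Finset I}
    (hR : R ∈ rooms r) (d : Finset X × Finset I) :
    d ∈ (doors r c i).filter (fun d ↦ DoorOf d R) ↔
      (∃ j, j ∉ R.2 ∧ d = (R.1, insert j R.2) ∧ i ∈ insert j R.2 ∧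
        R.1.image c = (insert j R.2).erase i) ∨
      (∃ x ∈ R.1, d = (R.1.erase x, R.2) ∧ i ∈ R.2 ∧ (R.1.erase x).image c = R.2.erase i) := by
  obtain ⟨hRd, hRc⟩ : IsDominant r R.1 R.2 ∧ R.1.card = R.2.card := by simpa [rooms] using hR
  simp only [doors, Finset.mem_filter, Finset.mem_univ, true_and]
  constructor
  · rintro ⟨⟨-, h1, h2, h3⟩, h⟩
    obtain ⟨τ, D⟩ := d
    rcases h.cases h1 hRc with ⟨h4, j, hj, h5⟩ | ⟨h4, x, hx, h5⟩
    · left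
      have : insert j R.2 = D := by rw [h5, Finset.insert_erase hj]
      refine ⟨j, by simp [h5], by rw [this, ← h4], by rwa [this], by rw [this, ← h4]; exact h3⟩
    · right
      exact ⟨x, hx, by rw [← h5, ← h4], h4 ▸ h2, by rw [← h5, ← h4]; exact h3⟩
  · rintro (⟨j, hj, rfl, h1, h2⟩ | ⟨x, hx, rfl, h1, h2⟩)
    · have hs := Finset.subset_insert j R.2
      exact ⟨⟨hRd.mono subset_rfl hs, by
        rw [Finset.card_insert_of_notMem hj, hRc], h1, h2⟩, subset_rfl, hs⟩
    · have hs := Finset.erase_subset x R.1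
      have := Finset.card_pos.2 ⟨x, hx⟩
      refine ⟨⟨hRd.mono hs subset_rfl, ?_, h1, h2⟩, hs, subset_rfl⟩
      change R.2.card = _
      rw [Finset.card_erase_of_mem hx]; omega

open Classical in
theorem even_card_doors_of_room [Fintype X] [Fintype I] {r : I → X → L} {c : X → I} {i : I} {R : Finset X × Finset I}
    (hR : R ∈ rooms r) (hcol : R.1.image c ≠ R.2) :
    Even ((doors r c i).filter (fun d ↦ DoorOf d R)).card := by
  have hmem := mem_doors_of_room (c := c) (i := i) hR
  have hRc : R.1.card = R.2.card := by
    have : IsDominant r R.1 R.2 ∧ R.1.card = R.2.card := by simpa [rooms] using hR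
    exact this.2
  obtain ⟨σ, C⟩ := R
  simp only at hmem hcol hRc
  rcases Finset.eq_empty_or_nonempty ((doors r c i).filter (fun d ↦ DoorOf d (σ, C))) with h0 | h0
  · simp [h0]
  have hex : ∃ x ∈ σ, i ∈ C ∧ (σ.erase x).image c = C.erase i := by
    obtain ⟨d, hd⟩ := h0
    rcases (hmem d).1 hd with ⟨j, hj, -, h1, h2⟩ | ⟨x, hx, -, h1, h2⟩
    · have hij : i ≠ j := by
        rintro rfl
        rw [Finset.erase_insert hj] at h2
        exact hcol h2
      have hiC : i ∈ C := (Finset.mem_insert.1 h1).resolve_left hij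
      have hj' : j ∈ σ.image c := by rw [h2]; simp [hij.symm]
      obtain ⟨x, hx, hxj⟩ := Finset.mem_image.1 hj'
      have hinj : Set.InjOn c σ := by
        rw [← Finset.card_image_iff, h2, Finset.card_erase_of_mem h1,
          Finset.card_insert_of_notMem hj, hRc]
        simp
      refine ⟨x, hx, hiC, ?_⟩
      ext k
      have hk : k ∈ σ.image c ↔ k ∈ (insert j C).erase i := by rw [h2]
      simp only [Finset.mem_image, Finset.mem_erase, Finset.mem_insert] at hk ⊢
      constructor
      · rintro ⟨y, ⟨hyx, hy⟩, rfl⟩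
        have := hk.1 ⟨y, hy, rfl⟩
        refine ⟨this.1, this.2.resolve_left fun h ↦ hyx (hinj hy hx (h.trans hxj.symm))⟩
      · rintro ⟨hki, hkC⟩
        obtain ⟨y, hy, rfl⟩ := hk.2 ⟨hki, Or.inr hkC⟩
        exact ⟨y, ⟨fun h ↦ hj (by rwa [h, hxj] at hkC), hy⟩, rfl⟩
    · exact ⟨x, hx, h1, h2⟩
  obtain ⟨x, hx, hiC, himg⟩ := hex
  have hinj : Set.InjOn c (σ.erase x) := by
    rw [← Finset.card_image_iff, himg, Finset.card_erase_of_mem hx, Finset.card_erase_of_mem hiC,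
      hRc]
  have himgσ : σ.image c = insert (c x) (C.erase i) := by
    rw [← himg, ← Finset.image_insert, Finset.insert_erase hx]
  have hxi : c x ≠ i := by
    rintro h
    rw [h, Finset.insert_erase hiC] at himgσ
    exact hcol himgσ
  suffices hs : ((doors r c i).filter (fun d ↦ DoorOf d (σ, C))).card = 2 by
    rw [hs]; exact even_two
  rw [Finset.card_eq_two]
  by_cases hxC : c x ∈ C
  · obtain ⟨y, hy, hyx⟩ : ∃ y ∈ σ.erase x, c y = c x := by
      rw [← Finset.mem_image, himg]; exact Finset.mem_erase.2 ⟨hxi, hxC⟩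
    obtain ⟨hyne, hyσ⟩ := Finset.mem_erase.1 hy
    refine ⟨(σ.erase x, C), (σ.erase y, C), ?_, ?_⟩
    · intro h
      have h2 : σ.erase x = σ.erase y := congrArg Prod.fst h
      exact Finset.notMem_erase y σ (h2 ▸ hy)
    · ext d
      rw [hmem, Finset.mem_insert, Finset.mem_singleton]
      have himgy : (σ.erase y).image c = (σ.erase x).image c := by
        ext k; simp only [Finset.mem_image, Finset.mem_erase]; grind
      constructor
      · rintro (⟨j, hj, -, h1, h2⟩ | ⟨z, hz, rfl, -, h2⟩)
        · exfalso
          have : j ∈ insert (c x) (C.erase i) := by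
            rw [← himgσ, h2]
            exact Finset.mem_erase.2 ⟨fun h ↦ hj (h ▸ hiC), Finset.mem_insert_self _ _⟩
          rcases Finset.mem_insert.1 this with rfl | h
          · exact hj hxC
          · exact hj (Finset.mem_of_mem_erase h)
        · by_contra! hne
          have hzx : z ≠ x := fun h ↦ hne.1 (h ▸ rfl)
          have hzy : z ≠ y := fun h ↦ hne.2 (h ▸ rfl)
          have hinjz : Set.InjOn c (σ.erase z) := by
            rw [← Finset.card_image_iff, h2, Finset.card_erase_of_mem hz,
              Finset.card_erase_of_mem hiC, hRc]
          exact hyne (hinjz (by simp [hyσ, hzy.symm]) (by simp [hx, hzx.symm]) hyx)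
      · rintro (rfl | rfl)
        · exact Or.inr ⟨x, hx, rfl, hiC, himg⟩
        · exact Or.inr ⟨y, hyσ, rfl, hiC, himgy.trans himg⟩
  · refine ⟨(σ.erase x, C), (σ, insert (c x) C), ?_, ?_⟩
    · intro h
      have h2 : σ.erase x = σ := congrArg Prod.fst h
      exact Finset.notMem_erase x σ (h2.symm ▸ hx)
    · ext d
      rw [hmem, Finset.mem_insert, Finset.mem_singleton]
      constructor
      · rintro (⟨j, hj, rfl, h1, h2⟩ | ⟨z, hz, rfl, -, h2⟩)
        · right
          have : j ∈ insert (c x) (C.erase i) := by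
            rw [← himgσ, h2]
            exact Finset.mem_erase.2 ⟨fun h ↦ hj (h ▸ hiC), Finset.mem_insert_self _ _⟩
          rcases Finset.mem_insert.1 this with rfl | h
          · rfl
          · exact absurd (Finset.mem_of_mem_erase h) hj
        · left
          by_contra! hne
          have hzx : z ≠ x := fun h ↦ hne (h ▸ rfl)
          have : c x ∈ (σ.erase z).image c :=
            Finset.mem_image_of_mem c (Finset.mem_erase.2 ⟨hzx.symm, hx⟩)
          rw [h2] at this
          exact hxC (Finset.mem_of_mem_erase this)
      · rintro (rfl | rfl)
        · exact Or.inr ⟨x, hx, rfl, hiC, himg⟩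
        · refine Or.inl ⟨c x, hxC, rfl, Finset.mem_insert_of_mem hiC, ?_⟩
          rw [himgσ, Finset.erase_insert_of_ne hxi]

/-- **Scarf's combinatorial lemma**, for finitely many linear orders on a finite set. -/
theorem exists_isDominant_image_eq [Fintype X] [Fintype I] [Nonempty X] [Nonempty I]
    {r : I → X → L} (hr : ∀ i, Function.Injective (r i)) (c : X → I) :
    ∃ (C : Finset X) (J : Finset I), IsDominant r C J ∧ ∀ j ∈ J, ∃ x ∈ C, c x = j := by
  classical
  by_contra! hcon
  obtain ⟨i⟩ := ‹Nonempty I›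
  have hcount := Finset.sum_card_bipartiteAbove_eq_sum_card_bipartiteBelow
    (s := doors r c i) (t := rooms r) (fun d R ↦ DoorOf d R)
  have heven : Even (∑ R ∈ rooms r, ((doors r c i).bipartiteBelow (fun d R ↦ DoorOf d R) R).card) :=
    Finset.even_sum _ fun R hR ↦ even_card_doors_of_room hR fun h ↦ by
      have hRd : IsDominant r R.1 R.2 ∧ R.1.card = R.2.card := by simpa [rooms] using hR
      obtain ⟨j, hj, hne⟩ := hcon _ _ hRd.1
      rw [← h] at hj
      obtain ⟨x, hx, hxj⟩ := Finset.mem_image.1 hj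
      exact hne x hx hxj
  rw [← hcount] at heven
  have hd0 : ((∅, {i}) : Finset X × Finset I) ∈ doors r c i := by
    simp only [doors, Finset.mem_filter, Finset.mem_univ, true_and]
    exact ⟨fun y ↦ ⟨i, by simp, by simp⟩, by simp, by simp, by simp⟩
  rw [← Finset.add_sum_erase _ _ hd0] at heven
  have hone : ((rooms r).bipartiteAbove (fun d R ↦ DoorOf d R) (∅, {i})).card = 1 :=
    card_rooms_of_empty_door hr i
  rw [hone] at heven
  have hrest : Even (∑ d ∈ (doors r c i).erase (∅, {i}),
      ((rooms r).bipartiteAbove (fun d R ↦ DoorOf d R) d).card) := by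
    refine Finset.even_sum _ fun d hd ↦ ?_
    obtain ⟨hne, hd⟩ := Finset.mem_erase.1 hd
    simp only [doors, Finset.mem_filter, Finset.mem_univ, true_and] at hd
    obtain ⟨h1, h2, h3, h4⟩ := hd
    obtain ⟨τ, D⟩ := d
    have hτ : τ.Nonempty := by
      rw [Finset.nonempty_iff_ne_empty]
      rintro rfl
      obtain ⟨k, rfl⟩ := Finset.card_eq_one.1 (h2.trans (by simp))
      simp only [Finset.mem_singleton] at h3
      exact hne (by rw [h3])
    have : ((rooms r).bipartiteAbove (fun d R ↦ DoorOf d R) (τ, D)).card = 2 :=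
      card_rooms_of_door hr hτ h1 h2
    rw [this]; exact even_two
  exact absurd ((Nat.even_add.1 heven).2 hrest) (by decide)

end Dominance

section Brouwer

theorem exists_le_of_mem_stdSimplex {ι : Type*} [Fintype ι] {p q : ι → ℝ}
    (hp : p ∈ stdSimplex ℝ ι) (hq : q ∈ stdSimplex ℝ ι) : ∃ i, p i ≤ q i := by
  have hne : (Finset.univ : Finset ι).Nonempty := by
    by_contra h
    have := hp.2
    rw [Finset.not_nonempty_iff_eq_empty.1 h] at this
    simp at this
  by_contra! h
  have := Finset.sum_lt_sum_of_nonempty hne (fun i _ ↦ h i)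
  rw [hp.2, hq.2] at this
  exact lt_irrefl _ this

theorem exists_almost_fixed_stdSimplex {ι : Type*} [Fintype ι] [Nonempty ι]
    {F : (ι → ℝ) → ι → ℝ} (hF : MapsTo F (stdSimplex ℝ ι) (stdSimplex ℝ ι)) {N : ℕ} (hN : 0 < N) :
    ∃ x ∈ stdSimplex ℝ ι, ∀ j, ∃ y ∈ stdSimplex ℝ ι,
      (∀ i, |x i - y i| ≤ Fintype.card ι / N) ∧ y j ≤ F y j + Fintype.card ι / N := by
  classical
  let X := {x : ι → Fin (N + 1) // ∑ i, (x i : ℕ) = N}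
  have hNR : (0 : ℝ) < N := by exact_mod_cast hN
  let P : X → ι → ℝ := fun x i ↦ ((x.1 i : ℕ) : ℝ) / N
  have hP : ∀ x, P x ∈ stdSimplex ℝ ι := fun x ↦ by
    refine ⟨fun i ↦ by positivity, ?_⟩
    rw [← Finset.sum_div, ← Nat.cast_sum, x.2, div_self hNR.ne']
  have mk : ∀ y : ι → ℕ, ∑ i, y i = N → ∃ x : X, ∀ i, (x.1 i : ℕ) = y i := fun y hy ↦ by
    have hle : ∀ i, y i < N + 1 := fun i ↦ by
      have := Finset.single_le_sum (f := y) (fun i _ ↦ Nat.zero_le _) (Finset.mem_univ i)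
      omega
    exact ⟨⟨fun i ↦ ⟨y i, hle i⟩, hy⟩, fun i ↦ rfl⟩
  have : Nonempty X := by
    obtain ⟨i⟩ := ‹Nonempty ι›
    obtain ⟨x, -⟩ := mk (Pi.single i N) (by simp)
    exact ⟨x⟩
  let r : ι → X → ℕ ×ₗ Fin (Fintype.card X) := fun i x ↦ toLex ((x.1 i : ℕ), Fintype.equivFin X x)
  have hr : ∀ i, Function.Injective (r i) := fun i x y h ↦ by
    have := congrArg (fun z ↦ (ofLex z).2) h
    simpa [r] using this
  have hrle : ∀ i x y, r i x ≤ r i y → (x.1 i : ℕ) ≤ y.1 i := fun i x y h ↦ by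
    rcases Prod.Lex.le_iff.1 h with h | h
    · exact le_of_lt h
    · exact le_of_eq h.1
  choose c hc using fun x : X ↦ exists_le_of_mem_stdSimplex (hP x) (hF (hP x))
  obtain ⟨C, J, hdom, hcol⟩ := exists_isDominant_image_eq hr c
  have hJne : J.Nonempty := by
    obtain ⟨j, hj, -⟩ := hdom (Classical.arbitrary X)
    exact ⟨j, hj⟩
  have hCne : C.Nonempty := by
    obtain ⟨j, hj⟩ := hJne
    obtain ⟨x, hx, -⟩ := hcol j hj
    exact ⟨x, hx⟩
  choose m hmC hm using fun j : ι ↦ C.exists_min_image (fun x : X ↦ (x.1 j : ℕ)) hCne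
  have hsum : N < ∑ j ∈ J, (((m j).1 j : ℕ) + 1) := by
    by_contra! hle
    obtain ⟨j₀, hj₀⟩ := hJne
    obtain ⟨y, hy⟩ := mk (fun i ↦ (if i ∈ J then ((m i).1 i : ℕ) + 1 else 0) +
      if i = j₀ then N - ∑ j ∈ J, (((m j).1 j : ℕ) + 1) else 0) (by
        rw [Finset.sum_add_distrib]
        simp only [Finset.sum_ite_mem, Finset.univ_inter, Finset.sum_ite_eq', Finset.mem_univ,
          if_true]
        omega)
    obtain ⟨j, hj, h⟩ := hdom y
    have h1 := hrle j _ _ (h (m j) (hmC j))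
    have h2 := hy j
    simp only [hj, if_true] at h2
    omega
  have hJcard : J.card ≤ Fintype.card ι := Finset.card_le_univ J
  rw [Finset.sum_add_distrib, Finset.sum_const, smul_eq_mul, mul_one] at hsum
  have hsplit : ∀ x : X, ∑ j ∈ J, (x.1 j : ℕ) + ∑ j ∈ Jᶜ, (x.1 j : ℕ) = N := fun x ↦ by
    rw [Finset.sum_add_sum_compl, x.2]
  have hout : ∀ x ∈ C, ∀ j ∉ J, (x.1 j : ℕ) ≤ Fintype.card ι := fun x hx j hj ↦ by
    have h1 := Finset.single_le_sum (f := fun j ↦ (x.1 j : ℕ)) (fun i _ ↦ Nat.zero_le _)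
      (Finset.mem_compl.2 hj)
    have h2 := Finset.sum_le_sum (s := J) (fun j _ ↦ hm j x hx)
    have h3 := hsplit x
    omega
  have hin : ∀ x ∈ C, ∀ j ∈ J, (x.1 j : ℕ) ≤ (m j).1 j + Fintype.card ι := fun x hx j hj ↦ by
    have h2 := Finset.sum_le_sum (s := J.erase j)
      (fun j _ ↦ hm j x hx)
    have h3 := hsplit x
    rw [← Finset.add_sum_erase _ _ hj] at h3 hsum
    omega
  have hclose : ∀ x ∈ C, ∀ y ∈ C, ∀ j, (x.1 j : ℕ) ≤ y.1 j + Fintype.card ι := fun x hx y hy j ↦ by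
    by_cases hj : j ∈ J
    · have h1 := hin x hx j hj
      have h2 := hm j y hy
      omega
    · have := hout x hx j hj
      omega
  have hclose' : ∀ x ∈ C, ∀ y ∈ C, ∀ j, P x j - P y j ≤ Fintype.card ι / N := fun x hx y hy j ↦ by
    have h : ((x.1 j : ℕ) : ℝ) ≤ (y.1 j : ℕ) + Fintype.card ι := by
      exact_mod_cast hclose x hx y hy j
    simp only [P]
    rw [← sub_div]
    gcongr
    linarith
  obtain ⟨x, hx⟩ := hCne
  refine ⟨P x, hP x, fun j ↦ ?_⟩
  by_cases hj : j ∈ J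
  · obtain ⟨y, hy, rfl⟩ := hcol j hj
    refine ⟨P y, hP y, fun i ↦ abs_sub_le_iff.2 ⟨hclose' x hx y hy i, hclose' y hy x hx i⟩, ?_⟩
    have := hc y
    have : (0 : ℝ) ≤ Fintype.card ι / N := by positivity
    linarith
  · refine ⟨P x, hP x, fun i ↦ by simp; positivity, ?_⟩
    have h1 := (hF (hP x)).1 j
    have h2 : P x j ≤ Fintype.card ι / N := by
      simp only [P]
      gcongr
      exact hout x hx j hj
    linarith

/-- **Brouwer's fixed point theorem** on the standard simplex. -/
theorem exists_fixed_stdSimplex {ι : Type*} [Fintype ι] [Nonempty ι]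
    {F : (ι → ℝ) → ι → ℝ} (hF : MapsTo F (stdSimplex ℝ ι) (stdSimplex ℝ ι))
    (hc : ContinuousOn F (stdSimplex ℝ ι)) : ∃ p ∈ stdSimplex ℝ ι, F p = p := by
  choose x hx y hy hxy hle using fun n : ℕ ↦ exists_almost_fixed_stdSimplex hF n.succ_pos
  obtain ⟨p, hp, φ, hφ, hlim⟩ := (isCompact_stdSimplex ℝ ι).tendsto_subseq hx
  have hδ : Tendsto (fun n : ℕ ↦ (Fintype.card ι : ℝ) / (φ n).succ) atTop (𝓝 0) :=
    ((tendsto_const_div_atTop_nhds_zero_nat (Fintype.card ι : ℝ)).comp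
      (tendsto_add_atTop_nat 1)).comp hφ.tendsto_atTop
  refine ⟨p, hp, ?_⟩
  have key : ∀ j, p j ≤ F p j := by
    intro j
    have hyp : Tendsto (fun n ↦ y (φ n) j) atTop (𝓝 p) := by
      rw [tendsto_pi_nhds] at hlim ⊢
      intro i
      have h0 : Tendsto (fun n ↦ x (φ n) i - y (φ n) j i) atTop (𝓝 0) :=
        squeeze_zero_norm (fun n ↦ hxy (φ n) j i) hδ
      simpa using (hlim i).sub h0
    have hFy : Tendsto (fun n ↦ F (y (φ n) j)) atTop (𝓝 (F p)) :=
      (hc p hp).tendsto.comp (tendsto_nhdsWithin_iff.2 ⟨hyp, .of_forall fun n ↦ hy (φ n) j⟩)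
    refine le_of_tendsto_of_tendsto' (tendsto_pi_nhds.1 hyp j)
      (by simpa using (tendsto_pi_nhds.1 hFy j).add hδ) fun n ↦ hle (φ n) j
  have hs := (Finset.sum_eq_sum_iff_of_le (s := Finset.univ) (fun j _ ↦ key j)).1
    (hp.2.trans (hF hp).2.symm)
  exact funext fun j ↦ (hs j (Finset.mem_univ j)).symm

end Brouwer

section Maharam

variable {T : Type*} {ℱ m : MeasurableSpace T} {μ : Measure T}

/-- Hahn decomposition relative to a sub-σ-algebra. -/
theorem exists_hahn_trim (hℱ : ℱ ≤ m) (α β : Measure T) [IsFiniteMeasure α] [IsFiniteMeasure β] :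
    ∃ H, MeasurableSet[ℱ] H ∧ (∀ E, MeasurableSet[ℱ] E → E ⊆ H → α E ≤ β E) ∧
      ∀ E, MeasurableSet[ℱ] E → E ⊆ Hᶜ → β E ≤ α E := by
  obtain ⟨H, hH, h1, h2⟩ := @hahn_decomposition T ℱ (β.trim hℱ) (α.trim hℱ) _ _
  refine ⟨H, hH, fun E hE hEH ↦ ?_, fun E hE hEH ↦ ?_⟩
  · simpa only [trim_measurableSet_eq hℱ hE] using h1 E hE hEH
  · simpa only [trim_measurableSet_eq hℱ hE] using h2 E hE hEH

/-- A set of positive measure has a non-null subset of at most half its conditional measure. -/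
theorem exists_subset_two_mul_le [IsFiniteMeasure μ] (hℱ : ℱ ≤ m)
    (hNE : ∀ D : Set T, MeasurableSet D → 0 < μ D → ∃ D₀ ⊆ D, MeasurableSet D₀ ∧
      ∀ E : Set T, MeasurableSet[ℱ] E → 0 < μ (symmDiff D₀ (D ∩ E)))
    {D : Set T} (hD : MeasurableSet D) (hpos : 0 < μ D) :
    ∃ C ⊆ D, MeasurableSet C ∧ 0 < μ C ∧
      ∀ E, MeasurableSet[ℱ] E → 2 * μ (C ∩ E) ≤ μ (D ∩ E) := by
  obtain ⟨D₀, hsub, hD₀, hne⟩ := hNE D hD hpos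
  obtain ⟨H, hH, h1, h2⟩ := exists_hahn_trim hℱ (μ.restrict D₀) (μ.restrict (D \ D₀))
  have hH' := hℱ _ hH
  have hC : MeasurableSet (D₀ ∩ H ∪ (D \ D₀) ∩ Hᶜ) :=
    (hD₀.inter hH').union ((hD.diff hD₀).inter hH'.compl)
  refine ⟨D₀ ∩ H ∪ (D \ D₀) ∩ Hᶜ, ?_, hC, ?_, fun E hE ↦ ?_⟩
  · grind
  · refine (hne Hᶜ hH.compl).trans_le (measure_mono ?_)
    intro t
    simp only [Set.mem_symmDiff, Set.mem_inter_iff, Set.mem_union, Set.mem_compl_iff, Set.mem_sdiff]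
    have := @hsub t
    tauto
  · have hE' := hℱ _ hE
    have a1 := h1 (E ∩ H) (hE.inter hH) Set.inter_subset_right
    have a2 := h2 (E ∩ Hᶜ) (hE.inter hH.compl) Set.inter_subset_right
    rw [Measure.restrict_apply (hE'.inter hH'), Measure.restrict_apply (hE'.inter hH')] at a1
    rw [Measure.restrict_apply (hE'.inter hH'.compl),
      Measure.restrict_apply (hE'.inter hH'.compl)] at a2
    have e1 : μ ((D₀ ∩ H ∪ (D \ D₀) ∩ Hᶜ) ∩ E) =
        μ (E ∩ H ∩ D₀) + μ (E ∩ Hᶜ ∩ (D \ D₀)) := by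
      rw [← measure_union _ ((hE'.inter hH'.compl).inter (hD.diff hD₀))]
      · congr 1; ext t; simp; tauto
      · rw [Set.disjoint_left]; intro t; simp; tauto
    have e2 : μ (D ∩ E) = μ (E ∩ H ∩ D₀) + μ (E ∩ Hᶜ ∩ (D \ D₀)) +
        (μ (E ∩ H ∩ (D \ D₀)) + μ (E ∩ Hᶜ ∩ D₀)) := by
      rw [← measure_inter_add_sdiff (D ∩ E) hH', ← measure_inter_add_sdiff (D ∩ E ∩ H) hD₀,
        ← measure_inter_add_sdiff ((D ∩ E) \ H) hD₀]
      have s1 : D ∩ E ∩ H ∩ D₀ = E ∩ H ∩ D₀ := by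
        ext t; have := @hsub t; simp; tauto
      have s2 : (D ∩ E ∩ H) \ D₀ = E ∩ H ∩ (D \ D₀) := by ext t; simp; tauto
      have s3 : (D ∩ E) \ H ∩ D₀ = E ∩ Hᶜ ∩ D₀ := by
        ext t; have := @hsub t; simp; tauto
      have s4 : ((D ∩ E) \ H) \ D₀ = E ∩ Hᶜ ∩ (D \ D₀) := by ext t; simp; tauto
      rw [s1, s2, s3, s4]
      ring
    rw [e1, e2, two_mul]
    gcongr

/-- A set of positive measure has non-null subsets of arbitrarily small conditional measure. -/
theorem exists_subset_two_pow_mul_le [IsFiniteMeasure μ] (hℱ : ℱ ≤ m)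
    (hNE : ∀ D : Set T, MeasurableSet D → 0 < μ D → ∃ D₀ ⊆ D, MeasurableSet D₀ ∧
      ∀ E : Set T, MeasurableSet[ℱ] E → 0 < μ (symmDiff D₀ (D ∩ E)))
    {D : Set T} (hD : MeasurableSet D) (hpos : 0 < μ D) (n : ℕ) :
    ∃ C ⊆ D, MeasurableSet C ∧ 0 < μ C ∧
      ∀ E, MeasurableSet[ℱ] E → 2 ^ n * μ (C ∩ E) ≤ μ (D ∩ E) := by
  induction n with
  | zero => exact ⟨D, subset_rfl, hD, hpos, fun E _ ↦ by simp⟩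
  | succ n ih =>
    obtain ⟨C, hCD, hC, hCpos, hCE⟩ := ih
    obtain ⟨C', hCC, hC', hCpos', hCE'⟩ := exists_subset_two_mul_le hℱ hNE hC hCpos
    refine ⟨C', hCC.trans hCD, hC', hCpos', fun E hE ↦ ?_⟩
    calc 2 ^ (n + 1) * μ (C' ∩ E) = 2 ^ n * (2 * μ (C' ∩ E)) := by ring
      _ ≤ 2 ^ n * μ (C ∩ E) := by gcongr; exact hCE' E hE
      _ ≤ μ (D ∩ E) := hCE E hE

/-- Exhaustion: a property of sets stable under increasing unions has an element which is maximal
up to null sets. -/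
theorem exists_maximal_measure_s16 [IsFiniteMeasure μ] {P : Set T → Prop} (h0 : P ∅)
    (hU : ∀ C : ℕ → Set T, Monotone C → (∀ n, P (C n)) → P (⋃ n, C n)) :
    ∃ C, P C ∧ ∀ C', C ⊆ C' → P C' → μ C' ≤ μ C := by
  have step : ∀ (n : ℕ) (C : {C // P C}), ∃ C' : {C // P C}, C.1 ⊆ C'.1 ∧
      ∀ B, C.1 ⊆ B → P B → μ B ≤ μ C'.1 + (n + 1 : ENNReal)⁻¹ := by
    intro n C
    set S := ⨆ B : {B // P B ∧ C.1 ⊆ B}, μ B.1 with hS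
    have hS_top : S ≠ ⊤ := ne_top_of_le_ne_top (measure_ne_top μ univ)
      (iSup_le fun B ↦ measure_mono (subset_univ _))
    have hle : ∀ B, C.1 ⊆ B → P B → μ B ≤ S := fun B hB hPB ↦
      le_iSup (fun B : {B // P B ∧ C.1 ⊆ B} ↦ μ B.1) ⟨B, hPB, hB⟩
    by_cases hS0 : S = 0
    · exact ⟨C, subset_rfl, fun B hB hPB ↦ (hle B hB hPB).trans (by simp [hS0])⟩
    · have : S - (n + 1 : ENNReal)⁻¹ < S := ENNReal.sub_lt_self hS_top hS0 (by simp)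
      obtain ⟨B', hB'⟩ := lt_iSup_iff.1 this
      exact ⟨⟨B'.1, B'.2.1⟩, B'.2.2, fun B hB hPB ↦
        (hle B hB hPB).trans (tsub_le_iff_right.1 hB'.le)⟩
  choose g hg1 hg2 using step
  let C : ℕ → {C // P C} := fun n ↦ Nat.rec ⟨∅, h0⟩ (fun n C ↦ g n C) n
  have hC : ∀ n, C (n + 1) = g n (C n) := fun n ↦ rfl
  have hmono : Monotone fun n ↦ (C n).1 := monotone_nat_of_le_succ fun n ↦ hg1 n (C n)
  refine ⟨⋃ n, (C n).1, hU _ hmono fun n ↦ (C n).2, fun C' hC' hP ↦ ?_⟩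
  have hlim : Tendsto (fun n : ℕ ↦ μ (⋃ n, (C n).1) + (n + 1 : ENNReal)⁻¹) atTop
      (𝓝 (μ (⋃ n, (C n).1) + 0)) := by
    refine tendsto_const_nhds.add ?_
    have := ENNReal.tendsto_inv_nat_nhds_zero.comp (tendsto_add_atTop_nat 1)
    simpa [Function.comp_def] using this
  rw [add_zero] at hlim
  refine ge_of_tendsto' hlim fun n ↦ ?_
  refine (hg2 n (C n) C' ((subset_iUnion (fun n ↦ (C n).1) n).trans hC') hP).trans ?_
  gcongr
  exact subset_iUnion (fun n ↦ (C n).1) (n + 1)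

/-- Every set can be split in two halves of equal conditional measure. -/
theorem exists_conditional_half [IsFiniteMeasure μ] (hℱ : ℱ ≤ m)
    (hNE : ∀ D : Set T, MeasurableSet D → 0 < μ D → ∃ D₀ ⊆ D, MeasurableSet D₀ ∧
      ∀ E : Set T, MeasurableSet[ℱ] E → 0 < μ (symmDiff D₀ (D ∩ E)))
    {D : Set T} (hD : MeasurableSet D) :
    ∃ C ⊆ D, MeasurableSet C ∧ ∀ E, MeasurableSet[ℱ] E → 2 * μ (C ∩ E) = μ (D ∩ E) := by
  obtain ⟨C, ⟨hCD, hC, hle⟩, hmax⟩ := exists_maximal_measure_s16 (μ := μ)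
    (P := fun C ↦ C ⊆ D ∧ MeasurableSet C ∧
      ∀ E, MeasurableSet[ℱ] E → 2 * μ (C ∩ E) ≤ μ (D ∩ E)) (by simp) (by
    intro C hmono hC
    refine ⟨iUnion_subset fun n ↦ (hC n).1, .iUnion fun n ↦ (hC n).2.1, fun E hE ↦ ?_⟩
    rw [iUnion_inter, Monotone.measure_iUnion
      (fun i j hij ↦ inter_subset_inter_left E (hmono hij)), ENNReal.mul_iSup]
    exact iSup_le fun n ↦ (hC n).2.2 E hE)
  refine ⟨C, hCD, hC, fun E hE ↦ le_antisymm (hle E hE) ?_⟩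
  by_contra! hlt
  obtain ⟨n, hn⟩ : ∃ n : ℕ, 2 * μ (C ∩ E) + 2 * (2⁻¹ ^ n * μ E) < μ (D ∩ E) := by
    have hlim : Tendsto (fun n : ℕ ↦ 2 * μ (C ∩ E) + 2 * ((2⁻¹ : ENNReal) ^ n * μ E)) atTop
        (𝓝 (2 * μ (C ∩ E) + 2 * (0 * μ E))) := by
      refine tendsto_const_nhds.add (ENNReal.Tendsto.const_mul ?_ (Or.inr (by simp)))
      refine ENNReal.Tendsto.mul_const ?_ (Or.inr (measure_ne_top _ _))
      exact ENNReal.tendsto_pow_atTop_nhds_zero_of_lt_one (by simp)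
    simp only [zero_mul, mul_zero, add_zero] at hlim
    exact (hlim.eventually_lt_const hlt).exists
  set δ : ENNReal := 2⁻¹ ^ n with hδ
  have hδ_top : δ ≠ ⊤ := by simp [hδ]
  have : IsFiniteMeasure (δ • μ) := μ.smul_finite hδ_top
  obtain ⟨H, hH, h1, h2⟩ := exists_hahn_trim hℱ
    (μ.restrict C + μ.restrict C + (δ • μ + δ • μ)) (μ.restrict D)
  have hform : ∀ G, MeasurableSet[ℱ] G →
      (μ.restrict C + μ.restrict C + (δ • μ + δ • μ)) G = 2 * μ (C ∩ G) + 2 * (δ * μ G) := by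
    intro G hG
    simp only [Measure.add_apply, Measure.restrict_apply (hℱ _ hG), Measure.smul_apply, smul_eq_mul]
    rw [inter_comm]; ring
  have hformD : ∀ G, MeasurableSet[ℱ] G → μ.restrict D G = μ (D ∩ G) := by
    intro G hG
    rw [Measure.restrict_apply (hℱ _ hG), inter_comm]
  have hE' := hℱ _ hE
  have hH' := hℱ _ hH
  have hS : MeasurableSet ((D \ C) ∩ H) := (hD.diff hC).inter hH'
  have hpos : 0 < μ ((D \ C) ∩ H) := by
    rw [pos_iff_ne_zero]
    intro hzero
    have b1 : μ (D ∩ (E ∩ H)) ≤ μ (C ∩ (E ∩ H)) := by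
      have : D ∩ (E ∩ H) ⊆ C ∩ (E ∩ H) ∪ (D \ C) ∩ H := by
        intro t; simp only [mem_inter_iff, mem_union, Set.mem_sdiff]; tauto
      refine (measure_mono this).trans ((measure_union_le _ _).trans ?_)
      rw [hzero, add_zero]
    have b2 := h2 (E ∩ Hᶜ) (hE.inter hH.compl) inter_subset_right
    rw [hform _ (hE.inter hH.compl), hformD _ (hE.inter hH.compl)] at b2
    have c1 : μ (D ∩ E) = μ (D ∩ (E ∩ H)) + μ (D ∩ (E ∩ Hᶜ)) := by
      rw [← measure_inter_add_sdiff (D ∩ E) hH', inter_assoc, Set.sdiff_eq, inter_assoc]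
    have c2 : μ (C ∩ E) = μ (C ∩ (E ∩ H)) + μ (C ∩ (E ∩ Hᶜ)) := by
      rw [← measure_inter_add_sdiff (C ∩ E) hH', inter_assoc, Set.sdiff_eq, inter_assoc]
    refine absurd hn (not_lt.2 ?_)
    rw [c1, c2]
    calc μ (D ∩ (E ∩ H)) + μ (D ∩ (E ∩ Hᶜ))
        ≤ 2 * μ (C ∩ (E ∩ H)) + (2 * μ (C ∩ (E ∩ Hᶜ)) + 2 * (δ * μ (E ∩ Hᶜ))) := by
          gcongr
          refine b1.trans ?_
          rw [two_mul]; exact le_self_add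
      _ ≤ 2 * μ (C ∩ (E ∩ H)) + (2 * μ (C ∩ (E ∩ Hᶜ)) + 2 * (δ * μ E)) := by
          gcongr; exact inter_subset_left
      _ = _ := by ring
  obtain ⟨S, hSsub, hSm, hSpos, hSle⟩ := exists_subset_two_pow_mul_le hℱ hNE hS hpos n
  have hSle' : ∀ G, MeasurableSet[ℱ] G → μ (S ∩ G) ≤ δ * μ (G ∩ H) := by
    intro G hG
    have h3 := hSle G hG
    have h4 : μ (D \ C ∩ H ∩ G) ≤ μ (G ∩ H) := measure_mono (by
      intro t; simp only [mem_inter_iff, Set.mem_sdiff]; tauto)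
    rw [hδ, ← ENNReal.inv_pow, mul_comm, ← div_eq_mul_inv,
      ENNReal.le_div_iff_mul_le (by simp) (by simp), mul_comm]
    exact h3.trans h4
  have hdisj : Disjoint C S := by
    rw [Set.disjoint_left]
    intro t ht hts
    exact (hSsub hts).1.2 ht
  have hbig := hmax (C ∪ S) subset_union_left ⟨union_subset hCD fun t ht ↦ (hSsub ht).1.1,
    hC.union hSm, fun G hG ↦ by
      have hG' := hℱ _ hG
      have d1 : μ ((C ∪ S) ∩ G) = μ (C ∩ (G ∩ H)) + μ (C ∩ (G ∩ Hᶜ)) + μ (S ∩ G) := by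
        rw [union_inter_distrib_right, measure_union _ (hSm.inter hG')]
        · congr 1
          rw [← measure_inter_add_sdiff (C ∩ G) hH', inter_assoc, Set.sdiff_eq, inter_assoc]
        · exact hdisj.mono inter_subset_left inter_subset_left
      have d2 : μ (D ∩ G) = μ (D ∩ (G ∩ H)) + μ (D ∩ (G ∩ Hᶜ)) := by
        rw [← measure_inter_add_sdiff (D ∩ G) hH', inter_assoc, Set.sdiff_eq, inter_assoc]
      have d3 := h1 (G ∩ H) (hG.inter hH) inter_subset_right
      rw [hform _ (hG.inter hH), hformD _ (hG.inter hH)] at d3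
      calc 2 * μ ((C ∪ S) ∩ G)
          = 2 * μ (C ∩ (G ∩ H)) + 2 * μ (S ∩ G) + 2 * μ (C ∩ (G ∩ Hᶜ)) := by rw [d1]; ring
        _ ≤ 2 * μ (C ∩ (G ∩ H)) + 2 * (δ * μ (G ∩ H)) + μ (D ∩ (G ∩ Hᶜ)) := by
            gcongr
            · exact hSle' G hG
            · exact hle _ (hG.inter hH.compl)
        _ ≤ μ (D ∩ (G ∩ H)) + μ (D ∩ (G ∩ Hᶜ)) := by gcongr
        _ = μ (D ∩ G) := d2.symm⟩
  rw [measure_union hdisj hSm] at hbig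
  exact absurd hbig (not_le.2 (ENNReal.lt_add_right (measure_ne_top _ _) hSpos.ne'))

/-- If `m` is conditionally atomless over `ℱ`, there is a uniform random variable independent
of `ℱ`. -/
theorem exists_uniform_indep [IsFiniteMeasure μ] (hℱ : ℱ ≤ m)
    (hNE : ∀ D : Set T, MeasurableSet D → 0 < μ D → ∃ D₀ ⊆ D, MeasurableSet D₀ ∧
      ∀ E : Set T, MeasurableSet[ℱ] E → 0 < μ (symmDiff D₀ (D ∩ E))) :
    ∃ X : T → unitInterval, Measurable X ∧ ∀ E, MeasurableSet[ℱ] E → ∀ B, MeasurableSet B →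
      μ (E ∩ X ⁻¹' B) = μ E * volume B := by
  have hhalf : ∀ D : Set T, ∃ C, MeasurableSet D → C ⊆ D ∧ MeasurableSet C ∧
      ∀ E, MeasurableSet[ℱ] E → 2 * μ (C ∩ E) = μ (D ∩ E) := fun D ↦ by
    by_cases hD : MeasurableSet D
    · obtain ⟨C, hC⟩ := exists_conditional_half hℱ hNE hD
      exact ⟨C, fun _ ↦ hC⟩
    · exact ⟨∅, fun h ↦ absurd h hD⟩
  choose half hhalf using hhalf
  let U : ℕ → ℕ → Set T := fun n ↦ Nat.rec (motive := fun _ ↦ ℕ → Set T) (fun k ↦ if k = 0 then ∅ else univ)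
    (fun _ V k ↦ if k % 2 = 0 then V (k / 2) else
      V (k / 2) ∪ half (V (k / 2 + 1) \ V (k / 2))) n
  have U0 : ∀ k, U 0 k = if k = 0 then ∅ else univ := fun k ↦ rfl
  have Ueven : ∀ n k, U (n + 1) (2 * k) = U n k := fun n k ↦ by
    change (if (2 * k) % 2 = 0 then U n (2 * k / 2) else _) = _
    simp
  have Uodd : ∀ n k, U (n + 1) (2 * k + 1) = U n k ∪ half (U n (k + 1) \ U n k) := fun n k ↦ by
    change (if (2 * k + 1) % 2 = 0 then _ else
      U n ((2 * k + 1) / 2) ∪ half (U n ((2 * k + 1) / 2 + 1) \ U n ((2 * k + 1) / 2))) = _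
    have h1 : (2 * k + 1) % 2 = 1 := by omega
    have h2 : (2 * k + 1) / 2 = k := by omega
    simp [h1, h2]
  have Um : ∀ n k, MeasurableSet (U n k) := by
    intro n
    induction n with
    | zero => intro k; rw [U0]; split_ifs <;> simp
    | succ n ih =>
      intro k
      rcases Nat.even_or_odd' k with ⟨j, rfl | rfl⟩
      · rw [Ueven]; exact ih j
      · rw [Uodd]; exact (ih j).union (hhalf _ ((ih _).diff (ih _))).2.1
  have Usucc : ∀ n k, U n k ⊆ U n (k + 1) := by
    intro n
    induction n with
    | zero => intro k; rw [U0, U0]; simp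
    | succ n ih =>
      intro k
      rcases Nat.even_or_odd' k with ⟨j, rfl | rfl⟩
      · rw [Ueven, Uodd]; exact subset_union_left
      · rw [Uodd, show 2 * j + 1 + 1 = 2 * (j + 1) by ring, Ueven]
        refine union_subset (ih j) ?_
        exact (hhalf _ ((Um n _).diff (Um n _))).1.trans sdiff_subset
  have Umono : ∀ n, Monotone (U n) := fun n ↦ monotone_nat_of_le_succ (Usucc n)
  have Upow : ∀ j n k, U (n + j) (2 ^ j * k) = U n k := by
    intro j
    induction j with
    | zero => simp
    | succ j ih =>
      intro n k
      rw [← add_assoc, show 2 ^ (j + 1) * k = 2 * (2 ^ j * k) by ring, Ueven, ih]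
  have Uzero : ∀ n, U n 0 = ∅ := by
    intro n
    have := Upow n 0 0
    simpa [U0] using this
  have Ustep : ∀ E, MeasurableSet[ℱ] E → ∀ n, ∀ k < 2 ^ n,
      2 ^ n * μ ((U n (k + 1) \ U n k) ∩ E) = μ E := by
    intro E hE n
    have hE' := hℱ _ hE
    induction n with
    | zero =>
      intro k hk
      obtain rfl : k = 0 := by simpa using hk
      simp [U0]
    | succ n ih =>
      intro k hk
      rcases Nat.even_or_odd' k with ⟨j, rfl | rfl⟩
      · obtain ⟨h1, h2, h3⟩ := hhalf _ ((Um n (j + 1)).diff (Um n j))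
        have hs : U (n + 1) (2 * j + 1) \ U (n + 1) (2 * j) = half (U n (j + 1) \ U n j) := by
          rw [Uodd, Ueven, union_sdiff_left]
          exact sdiff_eq_left.2 (disjoint_sdiff_left.mono_left h1)
        rw [hs, pow_succ, mul_assoc, h3 E hE]
        exact ih j (by rw [pow_succ] at hk; omega)
      · obtain ⟨h1, h2, h3⟩ := hhalf _ ((Um n (j + 1)).diff (Um n j))
        have hs : U (n + 1) (2 * j + 1 + 1) \ U (n + 1) (2 * j + 1) =
            (U n (j + 1) \ U n j) \ half (U n (j + 1) \ U n j) := by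
          rw [Uodd, show 2 * j + 1 + 1 = 2 * (j + 1) by ring, Ueven, sdiff_sdiff]
        have hsum : μ ((U n (j + 1) \ U n j) ∩ E) = μ (half (U n (j + 1) \ U n j) ∩ E) +
            μ (((U n (j + 1) \ U n j) \ half (U n (j + 1) \ U n j)) ∩ E) := by
          rw [← measure_inter_add_sdiff ((U n (j + 1) \ U n j) ∩ E) h2]
          congr 2
          · ext t; have := @h1 t; simp only [mem_inter_iff]; tauto
          · ext t; simp only [mem_inter_iff, Set.mem_sdiff]; tauto
        have heq : μ (((U n (j + 1) \ U n j) \ half (U n (j + 1) \ U n j)) ∩ E) =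
            μ (half (U n (j + 1) \ U n j) ∩ E) := by
          rw [← h3 E hE, two_mul] at hsum
          exact ((ENNReal.add_right_inj (measure_ne_top _ _)).1 hsum).symm
        rw [hs, heq, pow_succ, mul_assoc, h3 E hE]
        exact ih j (by rw [pow_succ] at hk; omega)
  have Umeas : ∀ E, MeasurableSet[ℱ] E → ∀ n, ∀ k ≤ 2 ^ n,
      μ.real (U n k ∩ E) = k / 2 ^ n * μ.real E := by
    intro E hE n k
    have hE' := hℱ _ hE
    induction k with
    | zero => intro _; simp [Uzero]
    | succ k ih =>
      intro hk
      have h1 : μ.real (U n (k + 1) ∩ E) =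
          μ.real (U n k ∩ E) + μ.real ((U n (k + 1) \ U n k) ∩ E) := by
        rw [← measureReal_union _ (((Um n _).diff (Um n _)).inter hE')]
        · congr 1
          ext t; have := @Usucc n k t; simp only [mem_inter_iff, mem_union, Set.mem_sdiff]; tauto
        · rw [Set.disjoint_left]; intro t; simp only [mem_inter_iff, Set.mem_sdiff]; tauto
      have h2 := congrArg ENNReal.toReal (Ustep E hE n k hk)
      rw [ENNReal.toReal_mul] at h2
      simp only [ENNReal.toReal_pow, ENNReal.toReal_ofNat] at h2
      change 2 ^ n * μ.real _ = μ.real E at h2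
      rw [h1, ih (by omega), ← h2]
      push_cast
      field_simp
  have Udec : ∀ n k t, Decidable (t ∈ U n k) := fun n k t ↦ Classical.propDecidable _
  let X : T → unitInterval := fun t ↦ ⨅ q : ℕ × ℕ,
    @ite _ (t ∈ U q.1 q.2) (Udec q.1 q.2 t) (projIcc (0 : ℝ) 1 zero_le_one (q.2 / 2 ^ q.1)) 1
  have hX : Measurable X := by
    refine Measurable.iInf fun q : ℕ × ℕ ↦ ?_
    exact Measurable.ite (p := fun t ↦ t ∈ U q.1 q.2) (Um _ _) measurable_const measurable_const
  have hXlt : ∀ t (x : unitInterval), X t < x ↔ ∃ n k, t ∈ U n k ∧ (k : ℝ) / 2 ^ n < x := by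
    intro t x
    simp only [X, iInf_lt_iff, Prod.exists]
    refine exists_congr fun n ↦ exists_congr fun k ↦ ?_
    rcases Classical.em (t ∈ U n k) with ht | ht
    · rw [@if_pos _ (Udec n k t) ht, ← Subtype.coe_lt_coe, coe_projIcc]
      have h0 : (0 : ℝ) ≤ k / 2 ^ n := by positivity
      simp only [ht, true_and, max_lt_iff, min_lt_iff]
      constructor
      · rintro ⟨-, h | h⟩
        · exact absurd h (not_lt.2 x.2.2)
        · exact h
      · exact fun h ↦ ⟨h0.trans_lt h, Or.inr h⟩
    · rw [@if_neg _ (Udec n k t) ht]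
      simp only [ht, false_and, iff_false, not_lt]
      exact x.2.2
  refine ⟨X, hX, fun E hE ↦ ?_⟩
  have hE' := hℱ _ hE
  have hlaw : ∀ x : unitInterval, μ.real (X ⁻¹' Iio x ∩ E) = x * μ.real E := by
    intro x
    have hbound : ∀ n : ℕ, |μ.real (X ⁻¹' Iio x ∩ E) - x * μ.real E| ≤ (1 / 2) ^ n * μ.real E := by
      intro n
      have h2n : (0 : ℝ) < 2 ^ n := by positivity
      set K := ⌈(x : ℝ) * 2 ^ n⌉₊ with hK
      have hKle : K ≤ 2 ^ n := by
        rw [hK, Nat.ceil_le]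
        push_cast
        exact mul_le_of_le_one_left h2n.le x.2.2
      have hx0 : 0 ≤ (x : ℝ) * 2 ^ n := mul_nonneg x.2.1 h2n.le
      have hK1 : (x : ℝ) ≤ K / 2 ^ n := by
        rw [le_div_iff₀ h2n]; exact Nat.le_ceil _
      have hK2 : (K : ℝ) / 2 ^ n ≤ x + (1 / 2) ^ n := by
        rw [div_le_iff₀ h2n, add_mul, ← mul_pow]
        simpa using (Nat.ceil_lt_add_one hx0).le
      have hup : μ.real (X ⁻¹' Iio x ∩ E) ≤ K / 2 ^ n * μ.real E := by
        rw [← Umeas E hE n K hKle]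
        refine measureReal_mono (inter_subset_inter_left _ fun t ht ↦ ?_)
        obtain ⟨p, k, htk, hlt⟩ := (hXlt t x).1 ht
        rw [← Upow n p k] at htk
        rw [← Upow p n K, add_comm n p]
        refine Umono _ ?_ htk
        have : (k : ℝ) / 2 ^ p ≤ K / 2 ^ n := hlt.le.trans hK1
        rw [div_le_div_iff₀ (by positivity) h2n] at this
        have h' : k * 2 ^ n ≤ K * 2 ^ p := by exact_mod_cast this
        linarith
      have hlow : (x - (1 / 2) ^ n) * μ.real E ≤ μ.real (X ⁻¹' Iio x ∩ E) := by
        rcases Nat.eq_zero_or_pos K with hK0 | hK0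
        · have : (x : ℝ) ≤ 0 := by simpa [hK0] using hK1
          refine le_trans ?_ measureReal_nonneg
          refine mul_nonpos_of_nonpos_of_nonneg ?_ measureReal_nonneg
          have : (0 : ℝ) ≤ (1 / 2) ^ n := by positivity
          linarith
        · have hcast : ((K - 1 : ℕ) : ℝ) = K - 1 := by
            rw [Nat.cast_sub hK0, Nat.cast_one]
          have hlt : ((K - 1 : ℕ) : ℝ) / 2 ^ n < x := by
            rw [div_lt_iff₀ h2n, ← Nat.lt_ceil]
            omega
          have hsub : U n (K - 1) ∩ E ⊆ X ⁻¹' Iio x ∩ E :=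
            inter_subset_inter_left _ fun t ht ↦ (hXlt t x).2 ⟨n, K - 1, ht, hlt⟩
          refine le_trans ?_ (measureReal_mono hsub)
          rw [Umeas E hE n (K - 1) (by omega), hcast, sub_div]
          refine mul_le_mul_of_nonneg_right ?_ measureReal_nonneg
          rw [one_div, one_div, inv_pow]
          linarith
      rw [abs_le]
      constructor
      · linarith
      · have := hup.trans (mul_le_mul_of_nonneg_right hK2 measureReal_nonneg)
        linarith
    have hlim : Tendsto (fun n : ℕ ↦ (1 / 2 : ℝ) ^ n * μ.real E) atTop (𝓝 (0 * μ.real E)) :=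
      (_root_.tendsto_pow_atTop_nhds_zero_of_lt_one (by norm_num) (by norm_num)).mul_const _
    rw [zero_mul] at hlim
    have := abs_nonpos_iff.1 (ge_of_tendsto' hlim hbound)
    linarith
  have hmeq : (μ.restrict E).map X = μ E • (volume : Measure unitInterval) := by
    have : IsFiniteMeasure (μ E • (volume : Measure unitInterval)) :=
      Measure.smul_finite _ (measure_ne_top _ _)
    have hIio : ∀ x, (μ.restrict E).map X (Iio x) =
        (μ E • (volume : Measure unitInterval)) (Iio x) := by
      intro x
      rw [Measure.map_apply hX measurableSet_Iio, Measure.restrict_apply (hX measurableSet_Iio),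
        Measure.smul_apply, unitInterval.volume_Iio, smul_eq_mul,
        ← ENNReal.ofReal_toReal (measure_ne_top μ E),
        ← ENNReal.ofReal_toReal (measure_ne_top μ (X ⁻¹' Iio x ∩ E)),
        ← ENNReal.ofReal_mul ENNReal.toReal_nonneg]
      congr 1
      rw [mul_comm]
      exact hlaw x
    refine Measure.ext_of_Ici _ _ fun x ↦ ?_
    have huniv : (μ.restrict E).map X univ = (μ E • (volume : Measure unitInterval)) univ := by
      rw [Measure.map_apply hX .univ]
      simp
    rw [← compl_Iio, measure_compl measurableSet_Iio (measure_ne_top _ _),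
      measure_compl measurableSet_Iio (measure_ne_top _ _), hIio, huniv]
  intro B hB
  have := congrArg (fun ν ↦ ν B) hmeq
  simp only [Measure.map_apply hX hB, Measure.restrict_apply (hX hB), Measure.smul_apply,
    smul_eq_mul] at this
  rw [inter_comm, this]

end Maharam

section Purification

open ProbabilityTheory

variable {Ω T A : Type*} [MeasurableSpace Ω] [MeasurableSpace T] {μ : Measure T}
  [MeasurableSpace A]

/-- Behavioural strategies depending on `π` can be purified using a uniform variable
independent of `π`. -/
theorem exists_purification [IsFiniteMeasure μ] [StandardBorelSpace A] [Nonempty A]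
    {π : T → Ω} (hπ : Measurable π) {X : T → unitInterval} (hX : Measurable X)
    (hind : ∀ S, MeasurableSet S → ∀ B, MeasurableSet B →
      μ (π ⁻¹' S ∩ X ⁻¹' B) = μ (π ⁻¹' S) * volume B)
    (κ : Kernel Ω A) [IsMarkovKernel κ] :
    ∃ f : T → A, Measurable f ∧ μ.map (fun t ↦ (π t, f t)) = (μ.map π) ⊗ₘ κ := by
  obtain ⟨φ, hφ, hφκ⟩ := Kernel.exists_measurable_map_eq_unitInterval κ
  have hjoint : μ.map (fun t ↦ (π t, X t)) = (μ.map π).prod volume := by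
    refine (Measure.prod_eq fun S B hS hB ↦ ?_).symm
    rw [Measure.map_apply (hπ.prodMk hX) (hS.prod hB), Measure.map_apply hπ hS, ← hind S hS B hB]
    rfl
  have hg : Measurable fun q : Ω × unitInterval ↦ (q.1, φ q.1 q.2) := measurable_fst.prodMk hφ
  refine ⟨fun t ↦ φ (π t) (X t), hφ.comp (hπ.prodMk hX), ?_⟩
  have hcomp : (fun t ↦ (π t, φ (π t) (X t))) =
      (fun q : Ω × unitInterval ↦ (q.1, φ q.1 q.2)) ∘ fun t ↦ (π t, X t) := rfl
  rw [hcomp, ← Measure.map_map hg (hπ.prodMk hX), hjoint]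
  ext s hs
  rw [Measure.map_apply hg hs, Measure.prod_apply (hg hs), Measure.compProd_apply hs]
  refine lintegral_congr fun ω ↦ ?_
  rw [← hφκ ω, Measure.map_apply hφ.of_uncurry_left (measurable_prodMk_left hs)]
  rfl

end Purification

section Equilibrium

open ProbabilityTheory BoundedContinuousFunction

variable {ι : Type*} [Fintype ι] {A : Type*} [MeasurableSpace A]

/-- The law of the points `x i` with weights `p i`. -/
noncomputable def pointLaw (x : ι → A) (p : stdSimplex ℝ ι) : ProbabilityMeasure A :=
  ⟨∑ i, ENNReal.ofReal (p.1 i) • Measure.dirac (x i), ⟨by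
    simp only [Measure.coe_finsetSum, Finset.sum_apply, Measure.smul_apply, measure_univ,
      smul_eq_mul, mul_one]
    rw [← ENNReal.ofReal_sum_of_nonneg fun i _ ↦ p.2.1 i, p.2.2, ENNReal.ofReal_one]⟩⟩

theorem pointLaw_apply (x : ι → A) (p : stdSimplex ℝ ι) (s : Set A) :
    (pointLaw x p : Measure A) s = ∑ i, ENNReal.ofReal (p.1 i) * Measure.dirac (x i) s := by
  change (∑ i, ENNReal.ofReal (p.1 i) • Measure.dirac (x i)) s = _
  simp only [Measure.coe_finsetSum, Finset.sum_apply, Measure.smul_apply, smul_eq_mul]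

theorem continuous_pointLaw [TopologicalSpace A] [OpensMeasurableSpace A] (x : ι → A) :
    Continuous (pointLaw x) := by
  refine continuous_iff_continuousAt.2 fun p ↦ ?_
  refine ProbabilityMeasure.tendsto_iff_forall_integral_tendsto.2 fun φ ↦ ?_
  have h : ∀ q : stdSimplex ℝ ι, ∫ a, φ a ∂(pointLaw x q : Measure A) = ∑ i, q.1 i * φ (x i) := by
    intro q
    change ∫ a, φ a ∂(∑ i, ENNReal.ofReal (q.1 i) • Measure.dirac (x i)) = _
    have hφ : StronglyMeasurable φ := φ.continuous.stronglyMeasurable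
    rw [integral_finsetSum_measure fun i _ ↦ (φ.integrable _).smul_measure ENNReal.ofReal_ne_top]
    refine Finset.sum_congr rfl fun i _ ↦ ?_
    rw [integral_smul_measure, integral_dirac' _ _ hφ, ENNReal.toReal_ofReal (q.2.1 i),
      smul_eq_mul]
  simp only [h]
  exact Continuous.tendsto (continuous_finsetSum _ fun i _ ↦
    ((continuous_apply i).comp continuous_subtype_val).mul continuous_const) p

theorem exists_fixed_of_continuous_stdSimplex [Nonempty ι]
    {G : stdSimplex ℝ ι → stdSimplex ℝ ι} (hG : Continuous G) : ∃ p, G p = p := by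
  classical
  let F : (ι → ℝ) → ι → ℝ := fun p ↦ if h : p ∈ stdSimplex ℝ ι then (G ⟨p, h⟩).1 else p
  have hF : ∀ p : stdSimplex ℝ ι, F p.1 = (G p).1 := fun p ↦ dif_pos p.2
  obtain ⟨p, hp, hFp⟩ := exists_fixed_stdSimplex (F := F)
    (fun p hp ↦ by rw [hF ⟨p, hp⟩]; exact (G ⟨p, hp⟩).2)
    (by
      rw [continuousOn_iff_continuous_domRestrict]
      have : (stdSimplex ℝ ι).domRestrict F = fun p ↦ (G p).1 := funext hF
      rw [this]
      exact continuous_subtype_val.comp hG)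
  exact ⟨⟨p, hp⟩, Subtype.ext ((hF ⟨p, hp⟩).symm.trans hFp)⟩

/-- Truncated regret weights: `i` gets positive weight only if `y i` is within `ε` of the
maximum of `y`. -/
noncomputable def nearMaxWeight [Nonempty ι] (ε : ℝ) (y : ι → ℝ) (i : ι) : ℝ :=
  max 0 (y i - Finset.univ.sup' Finset.univ_nonempty y + ε) /
    ∑ j, max 0 (y j - Finset.univ.sup' Finset.univ_nonempty y + ε)

section Weight

variable [Nonempty ι] {ε : ℝ}

theorem nearMaxWeight_denom_pos (hε : 0 < ε) (y : ι → ℝ) :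
    0 < ∑ j, max 0 (y j - Finset.univ.sup' Finset.univ_nonempty y + ε) := by
  obtain ⟨k, -, hk⟩ := Finset.exists_mem_eq_sup' Finset.univ_nonempty y
  refine Finset.sum_pos' (fun _ _ ↦ le_max_left _ _) ⟨k, Finset.mem_univ _, ?_⟩
  rw [hk, sub_self, zero_add]
  exact lt_max_of_lt_right hε

theorem nearMaxWeight_nonneg (hε : 0 < ε) (y : ι → ℝ) (i : ι) : 0 ≤ nearMaxWeight ε y i :=
  div_nonneg (le_max_left _ _) (nearMaxWeight_denom_pos hε y).le

theorem sum_nearMaxWeight (hε : 0 < ε) (y : ι → ℝ) : ∑ i, nearMaxWeight ε y i = 1 := by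
  simp only [nearMaxWeight]
  rw [← Finset.sum_div, div_self (nearMaxWeight_denom_pos hε y).ne']

theorem nearMaxWeight_mem (hε : 0 < ε) (y : ι → ℝ) : nearMaxWeight ε y ∈ stdSimplex ℝ ι :=
  ⟨nearMaxWeight_nonneg hε y, sum_nearMaxWeight hε y⟩

theorem le_add_of_nearMaxWeight_ne_zero {y : ι → ℝ} {i : ι} (h : nearMaxWeight ε y i ≠ 0)
    (j : ι) : y j ≤ y i + ε := by
  have hj := Finset.le_sup' y (Finset.mem_univ j)
  by_contra! hlt
  refine h ?_
  rw [nearMaxWeight, max_eq_left (by linarith), zero_div]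

theorem continuous_nearMaxWeight (hε : 0 < ε) : Continuous (nearMaxWeight (ι := ι) ε) := by
  have hsup : Continuous fun y : ι → ℝ ↦ Finset.univ.sup' Finset.univ_nonempty y :=
    Continuous.finset_sup'_apply (f := fun i (y : ι → ℝ) ↦ y i) Finset.univ_nonempty
      fun i _ ↦ continuous_apply i
  have hnum : ∀ i, Continuous fun y : ι → ℝ ↦
      max 0 (y i - Finset.univ.sup' Finset.univ_nonempty y + ε) := fun i ↦
    continuous_const.max (((continuous_apply i).sub hsup).add continuous_const)
  exact continuous_pi fun i ↦ (hnum i).div (continuous_finsetSum _ fun j _ ↦ hnum j)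
    fun y ↦ (nearMaxWeight_denom_pos hε y).ne'

end Weight

/-- The graph law of a pulled back kernel. -/
theorem map_compProd_comap {Ω W : Type*} [MeasurableSpace Ω] [MeasurableSpace W] {m₀ : Measure Ω} [IsFiniteMeasure m₀]
    {w : Ω → W} (hw : Measurable w) (κ : Kernel W A) [IsMarkovKernel κ] :
    (m₀ ⊗ₘ κ.comap w hw).map (Prod.map w id) = (m₀.map w) ⊗ₘ κ := by
  have hm : Measurable (Prod.map w id : Ω × A → W × A) := hw.prodMap measurable_id
  ext s hs
  rw [Measure.map_apply hm hs, Measure.compProd_apply (hm hs), Measure.compProd_apply hs,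
    lintegral_map (Kernel.measurable_kernel_prodMk_left hs) hw]
  rfl

variable [MetricSpace A] [BorelSpace A]

/-- The payoffs of the actions given the action distribution `ν`. -/
noncomputable def payoffAt (U : A × ProbabilityMeasure A →ᵇ ℝ) (ν : ProbabilityMeasure A) :
    C(A, ℝ) :=
  (U.toContinuousMap.comp ContinuousMap.prodSwap).curry ν

theorem payoffAt_apply (U : A × ProbabilityMeasure A →ᵇ ℝ) (ν : ProbabilityMeasure A) (a : A) :
    payoffAt U ν a = U (a, ν) := rfl

theorem continuous_payoffAt (U : A × ProbabilityMeasure A →ᵇ ℝ) : Continuous (payoffAt U) :=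
  (U.toContinuousMap.comp ContinuousMap.prodSwap).curry.continuous

variable {Ω T : Type*} [MeasurableSpace Ω] [MeasurableSpace T] {μ : Measure T}
  [IsProbabilityMeasure μ] [CompactSpace A]
  {π : T → Ω} {u : Ω → (A × ProbabilityMeasure A →ᵇ ℝ)}

theorem measurable_payoff (hu : StronglyMeasurable u) (ν : ProbabilityMeasure A) :
    Measurable fun q : Ω × A ↦ u q.1 (q.2, ν) := by
  have hc : Continuous fun q : (A × ProbabilityMeasure A →ᵇ ℝ) × A ↦ q.1 (q.2, ν) :=
    continuous_fst.eval (continuous_snd.prodMk continuous_const)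
  exact (hc.comp_stronglyMeasurable ((hu.comp_measurable measurable_fst).prodMk
    measurable_snd.stronglyMeasurable)).measurable

/-- Approximate equilibrium among finitely many actions. -/
theorem exists_approx_equilibrium [Nonempty ι] (hπ : Measurable π)
    (hpur : ∀ κ : Kernel Ω A, IsMarkovKernel κ →
      ∃ f : T → A, Measurable f ∧ μ.map (fun t ↦ (π t, f t)) = (μ.map π) ⊗ₘ κ)
    (hu : StronglyMeasurable u) (x : ι → A) {ε : ℝ} (hε : 0 < ε) :
    ∃ f : T → A, Measurable f ∧ ∃ ν : ProbabilityMeasure A, (ν : Measure A) = μ.map f ∧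
      ∀ᵐ t ∂μ, ∀ i, u (π t) (x i, ν) ≤ u (π t) (f t, ν) + ε := by
  have : IsProbabilityMeasure (μ.map π) := Measure.isProbabilityMeasure_map hπ.aemeasurable
  let y : stdSimplex ℝ ι → Ω → ι → ℝ := fun p ω i ↦ u ω (x i, pointLaw x p)
  have hym : ∀ p, Measurable (y p) := fun p ↦ measurable_pi_lambda _ fun i ↦
    (measurable_payoff hu (pointLaw x p)).comp (measurable_id.prodMk measurable_const)
  have hyc : ∀ ω, Continuous fun p ↦ y p ω := fun ω ↦ continuous_pi fun i ↦
    (u ω).continuous.comp (continuous_const.prodMk (continuous_pointLaw x))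
  have hwm : ∀ p i, Measurable fun ω ↦ nearMaxWeight ε (y p ω) i := fun p i ↦
    (measurable_pi_apply i).comp ((continuous_nearMaxWeight hε).measurable.comp (hym p))
  have hbound : ∀ p i ω, ‖nearMaxWeight ε (y p ω) i‖ ≤ 1 := fun p i ω ↦ by
    rw [Real.norm_of_nonneg (nearMaxWeight_nonneg hε _ i), ← sum_nearMaxWeight hε (y p ω)]
    exact Finset.single_le_sum (fun j _ ↦ nearMaxWeight_nonneg hε _ j) (Finset.mem_univ i)
  have hint : ∀ p i, Integrable (fun ω ↦ nearMaxWeight ε (y p ω) i) (μ.map π) := fun p i ↦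
    Integrable.of_bound (hwm p i).aestronglyMeasurable 1 (ae_of_all _ (hbound p i))
  let G : stdSimplex ℝ ι → stdSimplex ℝ ι := fun p ↦
    ⟨fun i ↦ ∫ ω, nearMaxWeight ε (y p ω) i ∂(μ.map π),
      fun i ↦ integral_nonneg fun ω ↦ nearMaxWeight_nonneg hε _ i, by
        rw [← integral_finsetSum _ fun i _ ↦ hint p i]
        simp [sum_nearMaxWeight hε]⟩
  have hG : Continuous G := by
    refine Continuous.subtype_mk (continuous_pi fun i ↦ ?_) _
    exact continuous_of_dominated (fun p ↦ (hwm p i).aestronglyMeasurable)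
      (fun p ↦ ae_of_all _ (hbound p i)) (integrable_const 1)
      (ae_of_all _ fun ω ↦ (continuous_apply i).comp
        ((continuous_nearMaxWeight hε).comp (hyc ω)))
  obtain ⟨p, hp⟩ := exists_fixed_of_continuous_stdSimplex hG
  let w : Ω → stdSimplex ℝ ι := fun ω ↦ ⟨nearMaxWeight ε (y p ω), nearMaxWeight_mem hε _⟩
  let κ : Kernel Ω A :=
    { toFun := fun ω ↦ pointLaw x (w ω)
      measurable' := by
        refine Measure.measurable_of_measurable_coe _ fun s hs ↦ ?_
        simp only [pointLaw_apply]
        exact Finset.measurable_fun_sum _ fun i _ ↦ (hwm p i).ennreal_ofReal.mul_const _ }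
  have hκ : ∀ ω, κ ω = pointLaw x (w ω) := fun _ ↦ rfl
  have hκM : IsMarkovKernel κ := ⟨fun ω ↦ by rw [hκ]; infer_instance⟩
  obtain ⟨f, hf, hfκ⟩ := hpur κ hκM
  have hlaw : (pointLaw x p : Measure A) = μ.map f := by
    have h1 : μ.map f = ((μ.map π) ⊗ₘ κ).snd := by
      rw [← hfκ, Measure.snd_map_prodMk hπ]
    ext s hs
    rw [h1, Measure.snd_compProd, Measure.bind_apply hs κ.measurable.aemeasurable]
    simp only [hκ, pointLaw_apply]
    rw [lintegral_finsetSum _ fun i _ ↦ (hwm p i).ennreal_ofReal.mul_const _]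
    refine Finset.sum_congr rfl fun i _ ↦ ?_
    rw [lintegral_mul_const _ (hwm p i).ennreal_ofReal,
      ← ofReal_integral_eq_lintegral_ofReal (hint p i)
        (ae_of_all _ fun ω ↦ nearMaxWeight_nonneg hε _ i)]
    have hi : p.1 i = ∫ ω, nearMaxWeight ε (y p ω) i ∂(μ.map π) :=
      congrFun (congrArg Subtype.val hp.symm) i
    rw [← hi]
  refine ⟨f, hf, pointLaw x p, hlaw, ?_⟩
  have hset : MeasurableSet {q : Ω × A | ∀ i, u q.1 (x i, pointLaw x p) ≤
      u q.1 (q.2, pointLaw x p) + ε} := by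
    rw [Set.ofPred_forall]
    refine MeasurableSet.iInter fun i ↦ measurableSet_le ?_ ?_
    · exact (measurable_payoff hu (pointLaw x p)).comp (measurable_fst.prodMk measurable_const)
    · exact (measurable_payoff hu (pointLaw x p)).add_const ε
  have hae : ∀ᵐ q ∂((μ.map π) ⊗ₘ κ), ∀ i, u q.1 (x i, pointLaw x p) ≤
      u q.1 (q.2, pointLaw x p) + ε := by
    rw [Measure.ae_compProd_iff hset]
    refine ae_of_all _ fun ω ↦ ?_
    have hms : MeasurableSet {a | ¬ ∀ i, u ω (x i, pointLaw x p) ≤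
        u ω (a, pointLaw x p) + ε} := (measurable_prodMk_left hset).compl
    rw [ae_iff, hκ, pointLaw_apply]
    refine Finset.sum_eq_zero fun i _ ↦ ?_
    rcases eq_or_ne (nearMaxWeight ε (y p ω) i) 0 with h0 | h0
    · simp [w, h0]
    · rw [Measure.dirac_apply' _ hms, indicator_of_notMem, mul_zero]
      simpa using le_add_of_nearMaxWeight_ne_zero h0
  rw [← hfκ] at hae
  exact ae_of_ae_map (hπ.prodMk hf).aemeasurable hae

theorem continuous_payoffAt_left (ν : ProbabilityMeasure A) :
    Continuous fun U : A × ProbabilityMeasure A →ᵇ ℝ ↦ payoffAt U ν := by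
  refine (LipschitzWith.of_dist_le_mul (K := 1) fun U V ↦ ?_).continuous
  rw [NNReal.coe_one, one_mul, ContinuousMap.dist_le dist_nonneg]
  exact fun a ↦ BoundedContinuousFunction.dist_coe_le_dist _

/-- Joint laws with a fixed first marginal on a Polish space and a compact second factor have
convergent subsequences. -/
theorem exists_subseq_tendsto_of_fst_eq {W : Type*} [TopologicalSpace W] [PolishSpace W]
    [MeasurableSpace W] [BorelSpace W] {ρ : Measure W} [IsFiniteMeasure ρ]
    (τ : ℕ → ProbabilityMeasure (W × A)) (hτ : ∀ n, (τ n : Measure (W × A)).fst = ρ) :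
    ∃ σ : ProbabilityMeasure (W × A), ∃ φ : ℕ → ℕ, StrictMono φ ∧
      Tendsto (fun n ↦ τ (φ n)) atTop (𝓝 σ) := by
  have htight : IsTightMeasureSet
      {x : Measure (W × A) | ∃ μ ∈ range τ, (μ : Measure (W × A)) = x} := by
    refine IsTightMeasureSet.prodMk ?_ IsTightMeasureSet.of_compactSpace
    refine (isTightMeasureSet_singleton (μ := ρ)).subset ?_
    rintro _ ⟨_, ⟨_, ⟨n, rfl⟩, rfl⟩, rfl⟩
    exact hτ n
  obtain ⟨σ, -, φ, hφ, h⟩ := (isCompact_closure_of_isTightMeasureSet htight).tendsto_subseq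
    fun n ↦ subset_closure (mem_range_self n)
  exact ⟨σ, φ, hφ, h⟩

/-- If strategies depending on `π` can be purified, the game with payoffs `u ∘ π` has a pure
equilibrium. -/
theorem exists_pure_equilibrium [Nonempty A] (hπ : Measurable π)
    (hpur : ∀ κ : Kernel Ω A, IsMarkovKernel κ →
      ∃ f : T → A, Measurable f ∧ μ.map (fun t ↦ (π t, f t)) = (μ.map π) ⊗ₘ κ)
    (hu : StronglyMeasurable u) :
    ∃ f : T → A, Measurable f ∧ ∃ ν : ProbabilityMeasure A, (ν : Measure A) = μ.map f ∧
      ∀ᵐ t ∂μ, ∀ a, u (π t) (a, ν) ≤ u (π t) (f t, ν) := by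
  have : IsProbabilityMeasure (μ.map π) := Measure.isProbabilityMeasure_map hπ.aemeasurable
  let d : ℕ → A := TopologicalSpace.denseSeq A
  have happrox : ∀ n : ℕ, ∃ f : T → A, Measurable f ∧ ∃ ν : ProbabilityMeasure A,
      (ν : Measure A) = μ.map f ∧ ∀ᵐ t ∂μ, ∀ i : Fin (n + 1),
        u (π t) (d i, ν) ≤ u (π t) (f t, ν) + 1 / ((n : ℝ) + 1) := fun n ↦
    exists_approx_equilibrium hπ hpur hu (fun i : Fin (n + 1) ↦ d i) Nat.one_div_pos_of_nat
  choose f₀ hf₀ ν₀ hν₀ hbest₀ using happrox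
  obtain ⟨ν, -, φ, hφ, hνlim⟩ := isCompact_univ.tendsto_subseq fun n ↦ mem_univ (ν₀ n)
  let : MeasurableSpace C(A, ℝ) := borel _
  have : BorelSpace C(A, ℝ) := ⟨rfl⟩
  let w : Ω → C(A, ℝ) := fun ω ↦ payoffAt (u ω) ν
  have hw : Measurable w := ((continuous_payoffAt_left ν).comp_stronglyMeasurable hu).measurable
  have hwπ : Measurable fun t ↦ w (π t) := hw.comp hπ
  let τ : ℕ → ProbabilityMeasure (C(A, ℝ) × A) := fun n ↦
    ⟨μ.map fun t ↦ (w (π t), f₀ (φ n) t),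
      Measure.isProbabilityMeasure_map (hwπ.prodMk (hf₀ _)).aemeasurable⟩
  have hτfst : ∀ n, (τ n : Measure (C(A, ℝ) × A)).fst = μ.map fun t ↦ w (π t) := fun n ↦
    Measure.fst_map_prodMk (hf₀ _)
  obtain ⟨σ, ψ, hψ, hσ⟩ := exists_subseq_tendsto_of_fst_eq τ hτfst
  have hσfst : (σ : Measure (C(A, ℝ) × A)).fst = (μ.map π).map w := by
    have h1 := ProbabilityMeasure.tendsto_map_of_tendsto_of_continuous _ _ hσ continuous_fst
    have h2 : ∀ n, (τ (ψ n)).map continuous_fst.measurable.aemeasurable =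
        (⟨(μ.map π).map w, Measure.isProbabilityMeasure_map hw.aemeasurable⟩ :
          ProbabilityMeasure C(A, ℝ)) := fun n ↦
      Subtype.ext <| (hτfst _).trans (Measure.map_map hw hπ).symm
    exact congrArg ProbabilityMeasure.toMeasure
      (tendsto_nhds_unique (h1.congr h2) tendsto_const_nhds)
  have hσsnd : (σ : Measure (C(A, ℝ) × A)).snd = ν := by
    have h1 := ProbabilityMeasure.tendsto_map_of_tendsto_of_continuous _ _ hσ continuous_snd
    have h2 : ∀ n, (τ (ψ n)).map continuous_snd.measurable.aemeasurable = ν₀ (φ (ψ n)) :=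
      fun n ↦ Subtype.ext <| (Measure.snd_map_prodMk hwπ).trans (hν₀ _).symm
    exact congrArg ProbabilityMeasure.toMeasure
      (tendsto_nhds_unique (h1.congr h2) (hνlim.comp hψ.tendsto_atTop))
  have hcl : Continuous fun q : C(A, ℝ) × A ↦ q.1 q.2 := continuous_fst.eval continuous_snd
  have hopt : ∀ᵐ q ∂(σ : Measure (C(A, ℝ) × A)), ∀ k, q.1 (d k) ≤ q.1 q.2 := by
    refine ae_all_iff.2 fun k ↦ ?_
    let h : C(A, ℝ) × A → ℝ := fun q ↦ max 0 (min 1 (q.1 (d k) - q.1 q.2))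
    have hh0 : ∀ q, 0 ≤ h q := fun q ↦ le_max_left _ _
    have hh1 : ∀ q, ‖h q‖ ≤ 1 := fun q ↦ by
      rw [Real.norm_of_nonneg (hh0 q)]
      exact max_le zero_le_one (min_le_left _ _)
    have hhc : Continuous h := continuous_const.max
      (continuous_const.min ((continuous_fst.eval continuous_const).sub hcl))
    let hb : C(A, ℝ) × A →ᵇ ℝ := BoundedContinuousFunction.ofNormedAddCommGroup h hhc 1 hh1
    have h1 : Tendsto (fun n ↦ ∫ q, h q ∂(τ (ψ n) : Measure (C(A, ℝ) × A))) atTop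
        (𝓝 (∫ q, h q ∂(σ : Measure (C(A, ℝ) × A)))) :=
      ProbabilityMeasure.tendsto_iff_forall_integral_tendsto.1 hσ hb
    have h2 : Tendsto (fun n ↦ ∫ q, h q ∂(τ (ψ n) : Measure (C(A, ℝ) × A))) atTop
        (𝓝 (∫ _, (0 : ℝ) ∂μ)) := by
      have heq : ∀ n, ∫ q, h q ∂(τ (ψ n) : Measure (C(A, ℝ) × A)) =
          ∫ t, h (w (π t), f₀ (φ (ψ n)) t) ∂μ := fun n ↦
        integral_map (hwπ.prodMk (hf₀ _)).aemeasurable hhc.aestronglyMeasurable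
      simp only [heq]
      refine tendsto_integral_of_dominated_convergence (fun _ ↦ 1)
        (fun n ↦ (hhc.measurable.comp (hwπ.prodMk (hf₀ _))).aestronglyMeasurable)
        (integrable_const 1) (fun n ↦ ae_of_all _ fun t ↦ hh1 _) ?_
      filter_upwards [ae_all_iff.2 hbest₀] with t ht
      have hθ : Tendsto (fun n ↦ φ (ψ n)) atTop atTop :=
        hφ.tendsto_atTop.comp hψ.tendsto_atTop
      have hdist : Tendsto (fun n ↦ 2 * dist (payoffAt (u (π t)) (ν₀ (φ (ψ n)))) (w (π t)) +
          1 / (((φ (ψ n) : ℕ) : ℝ) + 1)) atTop (𝓝 (2 * 0 + 0)) := by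
        refine (Tendsto.const_mul 2 ?_).add (tendsto_one_div_add_atTop_nhds_zero_nat.comp hθ)
        exact tendsto_iff_dist_tendsto_zero.1
          (((continuous_payoffAt (u (π t))).tendsto ν).comp (hνlim.comp hψ.tendsto_atTop))
      rw [mul_zero, zero_add] at hdist
      refine squeeze_zero' (Eventually.of_forall fun n ↦ hh0 _) ?_ hdist
      filter_upwards [hθ.eventually_ge_atTop k] with n hn
      refine max_le (by positivity) ((min_le_right _ _).trans ?_)
      have e1 := ht (φ (ψ n)) ⟨k, Nat.lt_succ_of_le hn⟩
      have e2 := ContinuousMap.dist_apply_le_dist (f := payoffAt (u (π t)) (ν₀ (φ (ψ n))))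
        (g := w (π t)) (d k)
      have e3 := ContinuousMap.dist_apply_le_dist (f := payoffAt (u (π t)) (ν₀ (φ (ψ n))))
        (g := w (π t)) (f₀ (φ (ψ n)) t)
      rw [Real.dist_eq, abs_le, payoffAt_apply] at e2 e3
      change w (π t) (d k) - w (π t) (f₀ (φ (ψ n)) t) ≤ _
      dsimp only at e1
      linarith [e2.1, e3.2]
    have h3 : ∫ q, h q ∂(σ : Measure (C(A, ℝ) × A)) = 0 := by
      simpa using tendsto_nhds_unique h1 h2
    rw [integral_eq_zero_iff_of_nonneg hh0 (hb.integrable _)] at h3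
    filter_upwards [h3] with q hq
    by_contra! hlt
    have : 0 < h q := lt_max_of_lt_right (lt_min one_pos (sub_pos.2 hlt))
    exact this.ne' hq
  obtain ⟨f, hf, hfκ⟩ := hpur ((σ : Measure (C(A, ℝ) × A)).condKernel.comap w hw) inferInstance
  have hjoint : μ.map (fun t ↦ (w (π t), f t)) = (σ : Measure (C(A, ℝ) × A)) := by
    have hm : Measurable (Prod.map w id : Ω × A → C(A, ℝ) × A) := hw.prodMap measurable_id
    have : (fun t ↦ (w (π t), f t)) = Prod.map w id ∘ fun t ↦ (π t, f t) := rfl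
    rw [this, ← Measure.map_map hm (hπ.prodMk hf), hfκ, map_compProd_comap hw, ← hσfst]
    exact Measure.disintegrate _ _
  refine ⟨f, hf, ν, ?_, ?_⟩
  · rw [← hσsnd, ← hjoint, Measure.snd_map_prodMk hwπ]
  · rw [← hjoint] at hopt
    filter_upwards [ae_of_ae_map (hwπ.prodMk hf).aemeasurable hopt] with t ht a
    exact (TopologicalSpace.denseRange_denseSeq A).induction_on
      (p := fun a ↦ w (π t) a ≤ w (π t) (f t)) a
      (isClosed_le (w (π t)).continuous continuous_const) ht

end Equilibrium

/-- Existence of a pure-strategy Nash equilibrium in a large anonymous game (one-point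
trait space): if `𝒯` is nowhere equivalent to `ℱ`, `A` is a nonempty compact metric
action space and `v : T → C_b(A × 𝓜(A))` is a strongly `ℱ`-measurable game, then there
is a `𝒯`-measurable `f : T → A` such that a.e. player plays a best response against
the induced action distribution `μ ∘ f⁻¹`. -/
theorem large_game_pure_nash_equilibrium
    {T : Type*} [𝒯 : MeasurableSpace T] (μ : Measure T) [IsProbabilityMeasure μ]
    (hcomplete : μ.IsComplete)
    (hatomless : ∀ D : Set T, MeasurableSet[𝒯] D → 0 < μ D →
      ∃ D₀ ⊆ D, MeasurableSet[𝒯] D₀ ∧ 0 < μ D₀ ∧ μ D₀ < μ D)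
    (ℱ : MeasurableSpace T) (hℱ : ℱ ≤ 𝒯)
    (hNE : ∀ D : Set T, MeasurableSet[𝒯] D → 0 < μ D →
      ∃ D₀ ⊆ D, MeasurableSet[𝒯] D₀ ∧
        ∀ E : Set T, MeasurableSet[ℱ] E → 0 < μ (symmDiff D₀ (D ∩ E)))
    {A : Type*} [MetricSpace A] [CompactSpace A] [Nonempty A]
    [MeasurableSpace A] [BorelSpace A]
    (v : T → BoundedContinuousFunction (A × ProbabilityMeasure A) ℝ)
    (hv : AEStronglyMeasurable v (μ.trim hℱ)) :
    ∃ f : T → A, Measurable[𝒯] f ∧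
      ∃ ν : ProbabilityMeasure A, (ν : Measure A) = @Measure.map T A 𝒯 _ f μ ∧
        ∀ᵐ t ∂μ, ∀ a : A, v t (a, ν) ≤ v t (f t, ν) := by
  obtain ⟨X, hX, hind⟩ := exists_uniform_indep hℱ hNE
  have hid : @Measurable T T 𝒯 ℱ id := measurable_id'' hℱ
  obtain ⟨f, hf, ν, hν, hbest⟩ := @exists_pure_equilibrium A _ _ _ T T ℱ 𝒯 μ _ _ id (hv.mk v) _
    hid (fun κ _ ↦ @exists_purification T T A ℱ 𝒯 μ _ _ _ _ id hid X hX
      (fun S hS B hB ↦ hind S hS B hB) κ _) hv.stronglyMeasurable_mk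
  refine ⟨f, hf, ν, hν, ?_⟩
  filter_upwards [hbest, ae_eq_of_ae_eq_trim hv.ae_eq_mk] with t ht hvt
  rw [hvt]
  exact ht
end
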